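/- arXiv:1806.05529 — 4 statements merged into one kernel-verified Lean document; each statement's English description precedes it below -/
import Mathlib

section
/- For every natural number n there exist a finite nilpotent group G whose nilpotency class is at least n, nontrivial finite cyclic groups F and H, and an action of the semidirect product F ⋊ H on G by group automorphisms, such that: (i) F ⋊ H is a Frobenius group with kernel F and complement H, i.e. every nontrivial element of H acts on F (by conjugation in F ⋊ H) without nontrivial fixed points; (ii) the fixed-point subgroup C_G(F) = {g ∈ G : x • g = g for all x ∈ F} is trivial; (iii) the fixed-point subgroup C_G(H) = {g ∈ G : y • g = g for all y ∈ H} is abelian. -/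
section TwistedToeplitz

variable {K : Type*} [CommRing K] {m : ℕ}

/-- The matrix with ones on the first superdiagonal and zeros elsewhere. -/
def shiftMatrix (K : Type*) [CommRing K] (m : ℕ) : Matrix (Fin (m + 1)) (Fin (m + 1)) K :=
  Matrix.of fun i j => if (i : ℕ) + 1 = j then 1 else 0

lemma shiftMatrix_mul_apply_castSucc (M : Matrix (Fin (m + 1)) (Fin (m + 1)) K) (i : Fin m)
    (j : Fin (m + 1)) : (shiftMatrix K m * M) i.castSucc j = M i.succ j := by
  rw [Matrix.mul_apply, Finset.sum_eq_single i.succ]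
  · simp [shiftMatrix]
  · intro b _ hb
    have : ¬ (i : ℕ) + 1 = b := fun h => hb (Fin.ext (by simp [← h]))
    simp [shiftMatrix, this]
  · simp

lemma mul_shiftMatrix_apply_succ (M : Matrix (Fin (m + 1)) (Fin (m + 1)) K) (i : Fin (m + 1))
    (j : Fin m) : (M * shiftMatrix K m) i j.succ = M i j.castSucc := by
  rw [Matrix.mul_apply, Finset.sum_eq_single j.castSucc]
  · simp [shiftMatrix]
  · intro b _ hb
    have : ¬ (b : ℕ) = j := fun h => hb (Fin.ext (by simp [h]))
    simp [shiftMatrix, this]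
  · simp

lemma mul_shiftMatrix_apply_zero (M : Matrix (Fin (m + 1)) (Fin (m + 1)) K) (i : Fin (m + 1)) :
    (M * shiftMatrix K m) i 0 = 0 := by
  simp [Matrix.mul_apply, shiftMatrix]

lemma shiftMatrix_pow_apply_zero (k : ℕ) (j : Fin (m + 1)) :
    (shiftMatrix K m ^ k) 0 j = if k = j then 1 else 0 := by
  induction k generalizing j with
  | zero => simp [Matrix.one_apply, Fin.ext_iff]
  | succ k ih =>
    rw [pow_succ]
    refine Fin.cases ?_ (fun j => ?_) j
    · simp [mul_shiftMatrix_apply_zero]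
    · simp [mul_shiftMatrix_apply_succ, ih]

lemma map_shiftMatrix (σ : K →+* K) : σ.mapMatrix (shiftMatrix K m) = shiftMatrix K m := by
  ext i j
  simp only [RingHom.mapMatrix_apply, Matrix.map_apply, shiftMatrix, Matrix.of_apply]
  split_ifs <;> simp

/-- The ring of matrices `M` with `M (i + 1) (j + 1) = σ (M i j)` and `M (i + 1) 0 = 0`, a model of
the truncated skew polynomial ring `K[t; σ] / (t ^ (m + 1))`. -/
def twistedToeplitz (m : ℕ) (σ : K →+* K) : Subring (Matrix (Fin (m + 1)) (Fin (m + 1)) K) where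
  carrier := {M | shiftMatrix K m * M = σ.mapMatrix M * shiftMatrix K m}
  mul_mem' {a b} ha hb := by
    simp only [Set.mem_ofPred_eq] at ha hb ⊢
    rw [← mul_assoc, ha, mul_assoc, hb, map_mul, mul_assoc]
  one_mem' := by simp only [Set.mem_ofPred_eq, mul_one, map_one, one_mul]
  add_mem' {a b} ha hb := by
    simp only [Set.mem_ofPred_eq] at ha hb ⊢
    rw [mul_add, ha, hb, map_add, add_mul]
  zero_mem' := by simp only [Set.mem_ofPred_eq, mul_zero, map_zero, zero_mul]
  neg_mem' {a} ha := by
    simp only [Set.mem_ofPred_eq] at ha ⊢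
    rw [mul_neg, ha, map_neg, neg_mul]

variable {σ : K →+* K} {M N : Matrix (Fin (m + 1)) (Fin (m + 1)) K}

lemma mem_twistedToeplitz_iff :
    M ∈ twistedToeplitz m σ ↔ shiftMatrix K m * M = σ.mapMatrix M * shiftMatrix K m :=
  Iff.rfl

lemma twistedToeplitz_apply_succ_zero (hM : M ∈ twistedToeplitz m σ) (i : Fin m) :
    M i.succ 0 = 0 := by
  rw [← shiftMatrix_mul_apply_castSucc M, mem_twistedToeplitz_iff.1 hM, mul_shiftMatrix_apply_zero]

lemma twistedToeplitz_apply_succ_succ (hM : M ∈ twistedToeplitz m σ) (i j : Fin m) :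
    M i.succ j.succ = σ (M i.castSucc j.castSucc) := by
  rw [← shiftMatrix_mul_apply_castSucc M, mem_twistedToeplitz_iff.1 hM, mul_shiftMatrix_apply_succ,
    RingHom.mapMatrix_apply, Matrix.map_apply]

/-- A twisted Toeplitz matrix is determined by its first row. -/
lemma twistedToeplitz_ext (hM : M ∈ twistedToeplitz m σ) (hN : N ∈ twistedToeplitz m σ)
    (h : ∀ j, M 0 j = N 0 j) : M = N := by
  suffices ∀ i j, M i j = N i j from Matrix.ext this
  intro i
  induction i using Fin.induction with
  | zero => exact h
  | succ i ih =>
    intro j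
    refine Fin.cases ?_ (fun j => ?_) j
    · rw [twistedToeplitz_apply_succ_zero hM, twistedToeplitz_apply_succ_zero hN]
    · rw [twistedToeplitz_apply_succ_succ hM, twistedToeplitz_apply_succ_succ hN, ih]

lemma units_inv_mem_twistedToeplitz {u : (Matrix (Fin (m + 1)) (Fin (m + 1)) K)ˣ}
    (hu : (u : Matrix _ _ K) ∈ twistedToeplitz m σ) :
    ((u⁻¹ : (Matrix (Fin (m + 1)) (Fin (m + 1)) K)ˣ) : Matrix _ _ K) ∈ twistedToeplitz m σ := by
  rw [mem_twistedToeplitz_iff] at hu ⊢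
  calc shiftMatrix K m * ↑u⁻¹
      = σ.mapMatrix (↑u⁻¹ * ↑u) * shiftMatrix K m * ↑u⁻¹ := by simp
    _ = σ.mapMatrix ↑u⁻¹ * (σ.mapMatrix ↑u * shiftMatrix K m) * ↑u⁻¹ := by
        rw [map_mul, mul_assoc (σ.mapMatrix _)]
    _ = σ.mapMatrix ↑u⁻¹ * shiftMatrix K m := by
        rw [← hu, mul_assoc, mul_assoc, Units.mul_inv, mul_one]

lemma shiftMatrix_mem_twistedToeplitz : shiftMatrix K m ∈ twistedToeplitz m σ := by
  rw [mem_twistedToeplitz_iff, map_shiftMatrix]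

/-- The embedding of the coefficient ring into the twisted Toeplitz matrices. -/
def twistedDiagonal (m : ℕ) (σ : K →+* K) : K →+* Matrix (Fin (m + 1)) (Fin (m + 1)) K :=
  (Matrix.diagonalRingHom (Fin (m + 1)) K).comp (RingHom.pi fun i : Fin (m + 1) => σ ^ (i : ℕ))

lemma twistedDiagonal_apply (a : K) :
    twistedDiagonal m σ a = Matrix.diagonal fun i : Fin (m + 1) => (σ ^ (i : ℕ)) a := rfl

lemma twistedDiagonal_mem (a : K) : twistedDiagonal m σ a ∈ twistedToeplitz m σ := by
  rw [mem_twistedToeplitz_iff]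
  ext i j
  simp only [twistedDiagonal_apply, Matrix.mul_diagonal, RingHom.mapMatrix_apply,
    Matrix.diagonal_map (map_zero σ), Matrix.diagonal_mul, shiftMatrix, Matrix.of_apply]
  split_ifs with h
  · rw [← h, pow_succ']
    simp
  · simp

/-- All entries below the `k`-th superdiagonal vanish. -/
def IsUpperFrom (k : ℕ) (M : Matrix (Fin (m + 1)) (Fin (m + 1)) K) : Prop :=
  ∀ i j : Fin (m + 1), (j : ℕ) < i + k → M i j = 0

lemma IsUpperFrom.mul {k l : ℕ} (hM : IsUpperFrom k M) (hN : IsUpperFrom l N) :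
    IsUpperFrom (k + l) (M * N) := by
  intro i j hij
  rw [Matrix.mul_apply]
  refine Finset.sum_eq_zero fun r _ => ?_
  by_cases hr : (r : ℕ) < i + k
  · rw [hM i r hr, zero_mul]
  · rw [hN r j (by omega), mul_zero]

lemma IsUpperFrom.mul_apply {k l : ℕ} (hM : IsUpperFrom k M) (hN : IsUpperFrom l N)
    {i r j : Fin (m + 1)} (hr : (r : ℕ) = i + k) (hj : (j : ℕ) = r + l) :
    (M * N) i j = M i r * N r j := by
  rw [Matrix.mul_apply, Finset.sum_eq_single r]
  · intro s _ hs
    by_cases h : (s : ℕ) < i + k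
    · rw [hM i s h, zero_mul]
    · have : (s : ℕ) ≠ r := fun h => hs (Fin.ext h)
      rw [hN s j (by omega), mul_zero]
  · simp

lemma IsUpperFrom.sub {k : ℕ} (hM : IsUpperFrom k M) (hN : IsUpperFrom k N) :
    IsUpperFrom k (M - N) := fun i j h => by
  rw [Matrix.sub_apply, hM i j h, hN i j h, sub_zero]

lemma IsUpperFrom.pow (hM : IsUpperFrom 1 M) (n : ℕ) : IsUpperFrom n (M ^ n) := by
  induction n with
  | zero =>
    intro i j h
    rw [pow_zero, Matrix.one_apply_ne]
    rintro rfl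
    omega
  | succ n ih => rw [pow_succ]; exact ih.mul hM

lemma IsUpperFrom.eq_zero {k : ℕ} (hM : IsUpperFrom k M) (hk : m < k) : M = 0 := by
  ext i j
  exact hM i j (by omega)

lemma IsUpperFrom.pow_eq_zero (hM : IsUpperFrom 1 M) {n : ℕ} (hn : m < n) : M ^ n = 0 :=
  (hM.pow n).eq_zero hn

lemma isUpperFrom_of_row_zero {k : ℕ} (hM : M ∈ twistedToeplitz m σ)
    (h : ∀ j : Fin (m + 1), (j : ℕ) < k → M 0 j = 0) : IsUpperFrom k M := by
  intro i
  induction i using Fin.induction with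
  | zero => intro j hj; exact h j (by simpa using hj)
  | succ i ih =>
    intro j
    refine Fin.cases (fun _ => ?_) (fun j hj => ?_) j
    · exact twistedToeplitz_apply_succ_zero hM i
    · rw [twistedToeplitz_apply_succ_succ hM, ih _ (by simp at hj ⊢; omega), map_zero]

lemma isUpperFrom_zero (hM : M ∈ twistedToeplitz m σ) : IsUpperFrom 0 M :=
  isUpperFrom_of_row_zero hM fun _ h => absurd h (Nat.not_lt_zero _)

lemma twistedToeplitz_diag (hM : M ∈ twistedToeplitz m σ) (h : M 0 0 = 1) (i : Fin (m + 1)) :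
    M i i = 1 := by
  induction i using Fin.induction with
  | zero => exact h
  | succ i ih => rw [twistedToeplitz_apply_succ_succ hM, ih, map_one]

lemma isUpperFrom_one_sub_one (hM : M ∈ twistedToeplitz m σ) (h : M 0 0 = 1) :
    IsUpperFrom 1 (M - 1) :=
  isUpperFrom_of_row_zero (sub_mem hM (one_mem _)) fun j hj => by
    obtain rfl : j = 0 := Fin.ext (by simpa using hj)
    simp [h]

/-- Matrices commuting with the shift matrix are polynomials in it, hence commute. -/
lemma commute_of_commute_shiftMatrix (hM : Commute (shiftMatrix K m) M)
    (hN : Commute (shiftMatrix K m) N) : Commute M N := by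
  have hid : ∀ {A : Matrix (Fin (m + 1)) (Fin (m + 1)) K},
      Commute (shiftMatrix K m) A → A ∈ twistedToeplitz m (RingHom.id K) := fun {A} hA => by
    rw [mem_twistedToeplitz_iff]
    simpa using hA.eq
  have key : M = ∑ k : Fin (m + 1), M 0 k • shiftMatrix K m ^ (k : ℕ) := by
    refine twistedToeplitz_ext (hid hM) (hid ?_) fun j => ?_
    · exact Commute.sum_right _ _ _ fun k _ => ((Commute.refl _).pow_right _).smul_right _
    · simp [Matrix.sum_apply, shiftMatrix_pow_apply_zero, Fin.val_inj]
  rw [key]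
  exact Commute.sum_left _ _ _ fun k _ => (hN.pow_left _).smul_left _

/-- The group of twisted Toeplitz matrices with ones on the diagonal. -/
def twistedUnitriangular (m : ℕ) (σ : K →+* K) :
    Subgroup (Matrix (Fin (m + 1)) (Fin (m + 1)) K)ˣ where
  carrier := {u | u.val ∈ twistedToeplitz m σ ∧ u.val 0 0 = 1}
  mul_mem' {a b} ha hb := by
    refine ⟨?_, ?_⟩
    · rw [Units.val_mul]; exact mul_mem ha.1 hb.1
    · rw [Units.val_mul, (isUpperFrom_zero ha.1).mul_apply (isUpperFrom_zero hb.1) (r := 0)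
        (by simp) (by simp), ha.2, hb.2, one_mul]
  one_mem' := ⟨by rw [Units.val_one]; exact one_mem _, by simp⟩
  inv_mem' {a} ha := by
    have hinv := units_inv_mem_twistedToeplitz ha.1
    refine ⟨hinv, ?_⟩
    have h := (isUpperFrom_zero ha.1).mul_apply (isUpperFrom_zero hinv) (i := 0) (r := 0) (j := 0)
      (by simp) (by simp)
    rw [Units.mul_inv, ha.2, one_mul, Matrix.one_apply_eq] at h
    exact h.symm

lemma mem_twistedUnitriangular_iff {u : (Matrix (Fin (m + 1)) (Fin (m + 1)) K)ˣ} :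
    u ∈ twistedUnitriangular m σ ↔ u.val ∈ twistedToeplitz m σ ∧ u.val 0 0 = 1 :=
  Iff.rfl

lemma isPGroup_twistedUnitriangular (p : ℕ) [Fact p.Prime] [CharP K p] :
    IsPGroup p (twistedUnitriangular m σ) := by
  rintro ⟨u, hu⟩
  obtain ⟨hu1, hu2⟩ := mem_twistedUnitriangular_iff.1 hu
  refine ⟨m + 1, Subtype.ext (Units.ext ?_)⟩
  have h := (isUpperFrom_one_sub_one hu1 hu2).pow_eq_zero (n := p ^ (m + 1))
    (m.lt_succ_self.trans (Nat.lt_pow_self (Fact.out : p.Prime).one_lt))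
  rw [sub_pow_char_pow_of_commute _ _ (Commute.one_right _), one_pow, sub_eq_zero] at h
  simpa using h

lemma exists_twistedUnitriangular_apply_zero_one (a : K) :
    ∃ g ∈ twistedUnitriangular m σ, ∀ i j : Fin (m + 1), (j : ℕ) = i + 1 →
      (g.val - 1) i j = (σ ^ (i : ℕ)) a := by
  set X := twistedDiagonal m σ a * shiftMatrix K m with hX
  have hXmem : X ∈ twistedToeplitz m σ :=
    mul_mem (twistedDiagonal_mem a) shiftMatrix_mem_twistedToeplitz
  have hX1 : IsUpperFrom 1 X := isUpperFrom_of_row_zero hXmem fun j hj => by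
    obtain rfl : j = 0 := Fin.ext (by simpa using hj)
    exact mul_shiftMatrix_apply_zero _ _
  have hnil : IsNilpotent X := ⟨m + 1, hX1.pow_eq_zero m.lt_succ_self⟩
  obtain ⟨u, hu⟩ := hnil.isUnit_one_add
  refine ⟨u, mem_twistedUnitriangular_iff.2 ⟨?_, ?_⟩, fun i j hij => ?_⟩
  · rw [hu]; exact add_mem (one_mem _) hXmem
  · rw [hu, Matrix.add_apply, hX1 0 0 (by simp), Matrix.one_apply_eq, add_zero]
  · rw [hu, add_sub_cancel_left, hX, twistedDiagonal_apply, Matrix.diagonal_mul]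
    simp [shiftMatrix, hij]

open scoped commutatorElement in
lemma exists_mem_lowerCentralSeries_twistedUnitriangular [NoZeroDivisors K] [Nontrivial K]
    (hσ : ∀ k, 0 < k → k ≤ m → ∃ a, (σ ^ k) a ≠ a) (k : ℕ) (hk : k < m) :
    ∃ g ∈ (⊤ : Subgroup (twistedUnitriangular m σ)).lowerCentralSeries k,
      IsUpperFrom (k + 1) (g.1.1 - 1) ∧
        (g.1.1 - 1) 0 ⟨k + 1, by omega⟩ ≠ 0 := by
  induction k with
  | zero =>
    obtain ⟨x, hx, hxa⟩ := exists_twistedUnitriangular_apply_zero_one (m := m) (σ := σ) 1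
    refine ⟨⟨x, hx⟩, by simp, isUpperFrom_one_sub_one hx.1 hx.2, ?_⟩
    rw [hxa 0 _ (by simp)]
    simp
  | succ k ih =>
    obtain ⟨g, hg, hgu, hg0⟩ := ih (by omega)
    set A := g.1.1 - 1 with hA
    set b := A 0 ⟨k + 1, by omega⟩ with hb
    obtain ⟨a, ha⟩ : ∃ a, b * (σ ^ (k + 1)) a - a * σ b ≠ 0 := by
      by_cases h : σ b = b
      · obtain ⟨a, ha⟩ := hσ (k + 1) (by omega) (by omega)
        refine ⟨a, ?_⟩
        rw [h, mul_comm a, ← mul_sub]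
        exact mul_ne_zero hg0 (sub_ne_zero.2 ha)
      · exact ⟨1, by simpa [sub_eq_zero] using Ne.symm h⟩
    obtain ⟨x, hx, hxa⟩ := exists_twistedUnitriangular_apply_zero_one (m := m) (σ := σ) a
    set X := x.val - 1 with hX
    have hXu : IsUpperFrom 1 X := isUpperFrom_one_sub_one hx.1 hx.2
    have hAmem : A ∈ twistedToeplitz m σ := sub_mem g.2.1 (one_mem _)
    set x' : twistedUnitriangular m σ := ⟨x, hx⟩
    set w := (x' * g)⁻¹ with hw
    have hcomm : (⁅g, x'⁆ : twistedUnitriangular m σ).1.1 - 1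
        = (A * X - X * A) * w.1.1 := by
      have h1 : A * X - X * A = g.1.1 * x.val - x.val * g.1.1 := by
        rw [hA, hX]; noncomm_ring
      have h2 : (⁅g, x'⁆ : twistedUnitriangular m σ) = g * x' * w := by
        rw [hw, commutatorElement_def]; group
      have h3 : (x.val * g.1.1) * w.1.1 = 1 := by
        have : x' * g * w = 1 := by rw [hw, mul_inv_cancel]
        simpa using congrArg
          (fun y : twistedUnitriangular m σ => y.1.1) this
      rw [h1, h2, sub_mul, h3]
      simp [x']
    have hAX : IsUpperFrom (k + 2) (A * X) := hgu.mul hXu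
    have hXA : IsUpperFrom (k + 2) (X * A) := by
      have := hXu.mul hgu
      rwa [show 1 + (k + 1) = k + 2 by omega] at this
    have hw0 : IsUpperFrom 0 w.1.1 := isUpperFrom_zero w.2.1
    refine ⟨⁅g, x'⁆, Subgroup.commutator_mem_commutator hg (Subgroup.mem_top _), ?_, ?_⟩
    · rw [hcomm]
      exact (hAX.sub hXA).mul hw0
    · have hA1 : A 1 ⟨k + 2, by omega⟩ = σ b := by
        obtain ⟨m, rfl⟩ : ∃ l, m = l + 1 := ⟨m - 1, by omega⟩
        exact twistedToeplitz_apply_succ_succ hAmem 0 ⟨k + 1, by omega⟩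
      rw [hcomm, (hAX.sub hXA).mul_apply hw0 (r := ⟨k + 2, by omega⟩) (by simp) (by simp),
        twistedToeplitz_diag w.2.1 w.2.2, mul_one, Matrix.sub_apply,
        hgu.mul_apply hXu (r := ⟨k + 1, by omega⟩) (by simp) (by simp),
        hXu.mul_apply hgu (r := 1) (by rw [Fin.val_one']; simp; omega)
          (by rw [Fin.val_one', Nat.mod_eq_of_lt (by omega)]; simp; omega),
        hxa _ _ (by simp), hxa 0 1 (by rw [Fin.val_one']; simp; omega), hA1, ← hb]
      simpa using ha

lemma le_nilpotencyClass_twistedUnitriangular [NoZeroDivisors K] [Nontrivial K]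
    [Group.IsNilpotent (twistedUnitriangular m σ)]
    (hσ : ∀ k, 0 < k → k ≤ m → ∃ a, (σ ^ k) a ≠ a) :
    m ≤ Group.nilpotencyClass (twistedUnitriangular m σ) := by
  by_contra! h
  obtain ⟨g, hg, -, hg0⟩ := exists_mem_lowerCentralSeries_twistedUnitriangular hσ _ h
  rw [Subgroup.lowerCentralSeries_nilpotencyClass, Subgroup.mem_bot] at hg
  simp [hg] at hg0

end TwistedToeplitz

section FrobeniusAction

variable {k K : Type*} [CommSemiring k] [CommRing K] [Algebra k K] {m : ℕ}

/-- The action of the automorphism group of an algebra on its group of units. -/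
def algEquivUnitsHom (k K : Type*) [CommSemiring k] [CommRing K] [Algebra k K] :
    (K ≃ₐ[k] K) →* MulAut Kˣ where
  toFun h := Units.mapEquiv (h : K ≃* K)
  map_one' := by ext; rfl
  map_mul' _ _ := by ext; rfl

lemma coe_algEquivUnitsHom_apply (h : K ≃ₐ[k] K) (x : Kˣ) :
    ((algEquivUnitsHom k K h x : Kˣ) : K) = h x := rfl

/-- Entrywise action of algebra automorphisms on invertible matrices. -/
def mapMatrixUnits (h : K ≃ₐ[k] K) :
    (Matrix (Fin (m + 1)) (Fin (m + 1)) K)ˣ →* (Matrix (Fin (m + 1)) (Fin (m + 1)) K)ˣ :=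
  Units.map (RingHom.mapMatrix (h : K →+* K)).toMonoidHom

lemma mapMatrixUnits_apply (h : K ≃ₐ[k] K) (u : (Matrix (Fin (m + 1)) (Fin (m + 1)) K)ˣ)
    (i j : Fin (m + 1)) : (mapMatrixUnits h u).val i j = h (u.val i j) := rfl

variable (p : ℕ) [ExpChar K p]

/-- The diagonal embedding of the units of the coefficient ring. -/
def twistedDiagonalUnits (m : ℕ) : Kˣ →* (Matrix (Fin (m + 1)) (Fin (m + 1)) K)ˣ :=
  Units.map (twistedDiagonal m (frobenius K p)).toMonoidHom

lemma coe_twistedDiagonalUnits (x : Kˣ) :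
    (twistedDiagonalUnits p m x).val = twistedDiagonal m (frobenius K p) x := rfl

lemma frobenius_pow_apply (n : ℕ) (x : K) : (frobenius K p ^ n) x = x ^ p ^ n := by
  rw [RingHom.coe_pow, ← coe_iterateFrobenius, iterateFrobenius_def]

lemma mapMatrixUnits_twistedDiagonalUnits (h : K ≃ₐ[k] K) (x : Kˣ) :
    mapMatrixUnits h (twistedDiagonalUnits p m x)
      = twistedDiagonalUnits p m (algEquivUnitsHom k K h x) := by
  refine Units.ext (Matrix.ext fun i j => ?_)
  rw [mapMatrixUnits_apply, coe_twistedDiagonalUnits, coe_twistedDiagonalUnits,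
    twistedDiagonal_apply, twistedDiagonal_apply, Matrix.diagonal_apply, Matrix.diagonal_apply]
  split_ifs
  · rw [frobenius_pow_apply, frobenius_pow_apply, coe_algEquivUnitsHom_apply, map_pow]
  · exact map_zero h

/-- Automorphisms of the coefficient ring act entrywise, and its units act by conjugation. -/
def semidirectActionFun (γ : Kˣ ⋊[algEquivUnitsHom k K] (K ≃ₐ[k] K))
    (u : (Matrix (Fin (m + 1)) (Fin (m + 1)) K)ˣ) : (Matrix (Fin (m + 1)) (Fin (m + 1)) K)ˣ :=
  twistedDiagonalUnits p m γ.left * mapMatrixUnits γ.right u * (twistedDiagonalUnits p m γ.left)⁻¹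

lemma mapMatrixUnits_mem (h : K ≃ₐ[k] K) {u : (Matrix (Fin (m + 1)) (Fin (m + 1)) K)ˣ}
    (hu : u ∈ twistedUnitriangular m (frobenius K p)) :
    mapMatrixUnits h u ∈ twistedUnitriangular m (frobenius K p) := by
  obtain ⟨h1, h2⟩ := mem_twistedUnitriangular_iff.1 hu
  refine mem_twistedUnitriangular_iff.2 ⟨?_, by rw [mapMatrixUnits_apply, h2, map_one]⟩
  have h3 := congrArg (RingHom.mapMatrix (h : K →+* K)) (mem_twistedToeplitz_iff.1 h1)
  rw [map_mul, map_mul, map_shiftMatrix] at h3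
  have h4 : RingHom.mapMatrix (h : K →+* K) ((frobenius K p).mapMatrix u.val)
      = (frobenius K p).mapMatrix (RingHom.mapMatrix (h : K →+* K) u.val) := by
    ext i j
    exact (h : K →+* K).map_frobenius p _
  rw [h4] at h3
  exact h3

lemma conj_twistedDiagonalUnits_mem (x : Kˣ) {u : (Matrix (Fin (m + 1)) (Fin (m + 1)) K)ˣ}
    (hu : u ∈ twistedUnitriangular m (frobenius K p)) :
    twistedDiagonalUnits p m x * u * (twistedDiagonalUnits p m x)⁻¹
      ∈ twistedUnitriangular m (frobenius K p) := by
  obtain ⟨h1, h2⟩ := mem_twistedUnitriangular_iff.1 hu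
  refine mem_twistedUnitriangular_iff.2 ⟨?_, ?_⟩
  · rw [← map_inv]
    exact mul_mem (mul_mem (twistedDiagonal_mem _) h1) (twistedDiagonal_mem _)
  · rw [← map_inv, Units.val_mul, Units.val_mul, coe_twistedDiagonalUnits,
      coe_twistedDiagonalUnits, twistedDiagonal_apply, twistedDiagonal_apply,
      Matrix.mul_diagonal, Matrix.diagonal_mul, h2, mul_one, ← map_mul, Units.mul_inv, map_one]

/-- The action of `Kˣ ⋊ Aut K` on the twisted unitriangular group. -/
abbrev twistedUnitriangularAction :
    MulDistribMulAction (Kˣ ⋊[algEquivUnitsHom k K] (K ≃ₐ[k] K))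
      (twistedUnitriangular m (frobenius K p)) where
  smul γ g := ⟨semidirectActionFun p γ g.1,
    conj_twistedDiagonalUnits_mem p _ (mapMatrixUnits_mem p _ g.2)⟩
  one_smul g := Subtype.ext <| by
    change semidirectActionFun p 1 g.1 = g.1
    simp only [semidirectActionFun, SemidirectProduct.one_left, SemidirectProduct.one_right,
      map_one, one_mul, inv_one, mul_one]
    rfl
  mul_smul γ δ g := Subtype.ext <| by
    change semidirectActionFun p (γ * δ) g.1
      = semidirectActionFun p γ (semidirectActionFun p δ g.1)
    have h : mapMatrixUnits (γ.right * δ.right) g.1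
      = mapMatrixUnits γ.right (mapMatrixUnits δ.right g.1) := rfl
    simp only [semidirectActionFun, SemidirectProduct.mul_left, SemidirectProduct.mul_right,
      map_mul, map_inv, mapMatrixUnits_twistedDiagonalUnits, h, mul_inv_rev, mul_assoc]
  smul_mul γ g g' := Subtype.ext <| by
    change semidirectActionFun p γ (g.1 * g'.1)
      = semidirectActionFun p γ g.1 * semidirectActionFun p γ g'.1
    simp only [semidirectActionFun, map_mul]
    group
  smul_one γ := Subtype.ext <| by
    change semidirectActionFun p γ 1 = 1
    simp only [semidirectActionFun, map_one, mul_one, mul_inv_cancel]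

/-- An element fixed by all units is trivial, provided that no nontrivial power of Frobenius with
exponent at most `m` is trivial. -/
lemma eq_one_of_conj_twistedDiagonalUnits_eq [IsDomain K]
    (hK : ∀ n, 0 < n → n ≤ m → ∃ x : Kˣ, (x : K) ^ p ^ n ≠ x)
    {u : (Matrix (Fin (m + 1)) (Fin (m + 1)) K)ˣ}
    (hu : u ∈ twistedUnitriangular m (frobenius K p))
    (h : ∀ x : Kˣ, twistedDiagonalUnits p m x * u * (twistedDiagonalUnits p m x)⁻¹ = u) :
    u = 1 := by
  obtain ⟨h1, h2⟩ := mem_twistedUnitriangular_iff.1 hu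
  refine Units.ext (twistedToeplitz_ext h1 (one_mem _) fun j => ?_)
  rcases eq_or_ne j 0 with rfl | hj
  · simpa using h2
  rw [Units.val_one, Matrix.one_apply_ne hj.symm]
  obtain ⟨x, hx⟩ := hK j (Nat.pos_of_ne_zero fun h0 => hj (Fin.ext h0)) (by omega)
  have h3 := congrArg (fun v : (Matrix (Fin (m + 1)) (Fin (m + 1)) K)ˣ => v.val 0 j)
    (mul_inv_eq_iff_eq_mul.1 (h x))
  simp only [Units.val_mul, coe_twistedDiagonalUnits, twistedDiagonal_apply, Matrix.mul_diagonal,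
    Matrix.diagonal_mul, frobenius_pow_apply, Fin.val_zero, pow_zero, pow_one] at h3
  rw [mul_comm, ← sub_eq_zero, ← mul_sub] at h3
  exact (mul_eq_zero.1 h3).resolve_right (sub_ne_zero.2 (Ne.symm hx))

/-- Elements with entries fixed by Frobenius commute. -/
lemma commute_of_apply_frobenius_eq {u v : (Matrix (Fin (m + 1)) (Fin (m + 1)) K)ˣ}
    (hu : u ∈ twistedUnitriangular m (frobenius K p))
    (hv : v ∈ twistedUnitriangular m (frobenius K p))
    (hu' : ∀ i j, frobenius K p (u.val i j) = u.val i j)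
    (hv' : ∀ i j, frobenius K p (v.val i j) = v.val i j) : Commute u v := by
  have key : ∀ w ∈ twistedUnitriangular m (frobenius K p),
      (∀ i j, frobenius K p (w.val i j) = w.val i j) → Commute (shiftMatrix K m) w.val := by
    intro w hw hw'
    have h := mem_twistedToeplitz_iff.1 (mem_twistedUnitriangular_iff.1 hw).1
    rwa [show (frobenius K p).mapMatrix w.val = w.val from Matrix.ext hw'] at h
  exact Units.ext (commute_of_commute_shiftMatrix (key u hu hu') (key v hv hv')).eq

end FrobeniusAction

lemma exists_units_pow_two_pow_ne (q n : ℕ) (hn : 0 < n) (hnq : n < q) :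
    ∃ x : (GaloisField 2 q)ˣ, (x : GaloisField 2 q) ^ 2 ^ n ≠ x := by
  have := Fintype.ofFinite (GaloisField 2 q)
  by_contra! h
  have h1 : ∀ x : (GaloisField 2 q)ˣ, x ^ (2 ^ n - 1) = 1 := fun x => by
    have h2 : x ^ (2 ^ n - 1) * x = x := by
      rw [← pow_succ, Nat.sub_add_cancel Nat.one_le_two_pow]
      exact Units.ext (h x)
    simpa using h2
  rw [FiniteField.forall_pow_eq_one_iff, ← Nat.card_eq_fintype_card,
    GaloisField.card 2 q (by omega)] at h1
  have h2 := Nat.le_of_dvd (Nat.sub_pos_of_lt (Nat.one_lt_two_pow hn.ne')) h1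
  have h3 : 2 ^ n < 2 ^ q := Nat.pow_lt_pow_right one_lt_two hnq
  have h4 : 1 ≤ 2 ^ n := Nat.one_le_two_pow
  omega

lemma card_algEquiv_galoisField (q : ℕ) (hq : q ≠ 0) :
    Nat.card (GaloisField 2 q ≃ₐ[ZMod 2] GaloisField 2 q) = q := by
  rw [IsGalois.card_aut_eq_finrank, GaloisField.finrank 2 hq]

/-- If the degree is prime, nontrivial field automorphisms fix no nontrivial unit. -/
lemma eq_one_of_algEquivUnitsHom_apply_eq {q : ℕ} (hq : q.Prime)
    {y : GaloisField 2 q ≃ₐ[ZMod 2] GaloisField 2 q} (hy : y ≠ 1) {x : (GaloisField 2 q)ˣ}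
    (hx : algEquivUnitsHom (ZMod 2) (GaloisField 2 q) y x = x) : x = 1 := by
  have := Fact.mk hq
  set f := FiniteField.frobeniusAlgEquivOfAlgebraic (ZMod 2) (GaloisField 2 q)
  have hf : f ∈ MulAction.stabilizer _ (x : GaloisField 2 q) := by
    refine (Subgroup.zpowers_le.2 ?_)
      (mem_zpowers_of_prime_card (card_algEquiv_galoisField q hq.ne_zero) hy (g' := f))
    exact congrArg Units.val hx
  have hf' : (x : GaloisField 2 q) ^ 2 = x := by
    have h1 : f x = x := hf
    simpa [f, FiniteField.coe_frobeniusAlgEquivOfAlgebraic] using h1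
  have h2 : x * x = x := Units.ext (by rw [Units.val_mul, ← sq, hf'])
  simpa using h2

/-- **Theorem 1.** For every natural number `n` there exist a finite nilpotent group `G` of
nilpotency class at least `n`, nontrivial finite cyclic groups `F` and `H`, and an action of
`F ⋊ H` on `G` by group automorphisms such that: `F ⋊ H` is a Frobenius group with kernel `F`
and complement `H` (every nontrivial element of `H` acts on `F` without nontrivial fixed
points), the fixed-point subgroup `C_G(F)` is trivial, and the fixed-point subgroup `C_G(H)`
is abelian. -/
theorem exists_finite_nilpotent_group_with_frobenius_action (n : ℕ) :
    ∃ (G : Type) (_ : Group G) (_ : Finite G)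
      (F H : Type) (_ : Group F) (_ : Group H),
      IsCyclic F ∧ IsCyclic H ∧ Finite F ∧ Finite H ∧ Nontrivial F ∧ Nontrivial H ∧
      ∃ (φ : H →* MulAut F) (_ : MulDistribMulAction (F ⋊[φ] H) G),
        -- (i) `F ⋊ H` is a Frobenius group with kernel `F` and complement `H`
        (∀ y : H, y ≠ 1 → ∀ x : F, φ y x = x → x = 1) ∧
        -- `G` is nilpotent of class at least `n`
        ∃ _ : Group.IsNilpotent G, n ≤ Group.nilpotencyClass G ∧
        -- (ii) the fixed-point subgroup of the kernel `F` is trivial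
        (∀ g : G, (∀ x : F, (SemidirectProduct.inl x : F ⋊[φ] H) • g = g) → g = 1) ∧
        -- (iii) the fixed-point subgroup of the complement `H` is abelian
        (∀ g₁ g₂ : G,
          (∀ y : H, (SemidirectProduct.inr y : F ⋊[φ] H) • g₁ = g₁) →
          (∀ y : H, (SemidirectProduct.inr y : F ⋊[φ] H) • g₂ = g₂) →
          Commute g₁ g₂) := by
  obtain ⟨q, hnq, hq⟩ := Nat.exists_infinite_primes (n + 1)
  obtain ⟨m, rfl⟩ : ∃ m, q = m + 1 := ⟨q - 1, by omega⟩
  have hK := fun k (hk : 0 < k) (hkm : k ≤ m) =>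
    exists_units_pow_two_pow_ne (m + 1) k hk (Nat.lt_succ_of_le hkm)
  have hcardF : Nat.card (GaloisField 2 (m + 1))ˣ = 2 ^ (m + 1) - 1 := by
    rw [Nat.card_units, GaloisField.card 2 _ hq.ne_zero]
  have hcardH := card_algEquiv_galoisField (m + 1) hq.ne_zero
  have hF : Nontrivial (GaloisField 2 (m + 1))ˣ := by
    have h4 : 2 ^ 2 ≤ 2 ^ (m + 1) := Nat.pow_le_pow_right two_pos hq.two_le
    exact Finite.one_lt_card_iff_nontrivial.1 (by omega)
  have hH : Nontrivial (GaloisField 2 (m + 1) ≃ₐ[ZMod 2] GaloisField 2 (m + 1)) :=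
    Finite.one_lt_card_iff_nontrivial.1 (hcardH.symm ▸ hq.one_lt)
  have hnil : Group.IsNilpotent
      (twistedUnitriangular m (frobenius (GaloisField 2 (m + 1)) 2)) :=
    (isPGroup_twistedUnitriangular 2).isNilpotent
  refine ⟨twistedUnitriangular m (frobenius (GaloisField 2 (m + 1)) 2), inferInstance,
    inferInstance, (GaloisField 2 (m + 1))ˣ, GaloisField 2 (m + 1) ≃ₐ[ZMod 2] GaloisField 2 (m + 1),
    inferInstance, inferInstance, inferInstance, inferInstance, inferInstance, inferInstance, hF,
    hH, algEquivUnitsHom _ _, twistedUnitriangularAction 2,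
    fun y hy x hx => eq_one_of_algEquivUnitsHom_apply_eq hq hy hx, hnil, ?_, ?_, ?_⟩
  · refine le_trans (by omega) (le_nilpotencyClass_twistedUnitriangular fun k hk hkm => ?_)
    obtain ⟨x, hx⟩ := hK k hk hkm
    exact ⟨x, by rwa [frobenius_pow_apply]⟩
  · intro g hg
    refine Subtype.ext (eq_one_of_conj_twistedDiagonalUnits_eq 2 hK g.2 fun x => ?_)
    exact congrArg Subtype.val (hg x)
  · have key : ∀ g : twistedUnitriangular m (frobenius (GaloisField 2 (m + 1)) 2),
        (∀ y, semidirectActionFun 2 (SemidirectProduct.inr y :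
          _ ⋊[algEquivUnitsHom (ZMod 2) (GaloisField 2 (m + 1))] _) g.1 = g.1) →
        ∀ i j, frobenius (GaloisField 2 (m + 1)) 2 (g.1.val i j) = g.1.val i j := by
      intro g hg i j
      have h := hg (FiniteField.frobeniusAlgEquivOfAlgebraic (ZMod 2) (GaloisField 2 (m + 1)))
      simp only [semidirectActionFun, SemidirectProduct.left_inr, SemidirectProduct.right_inr,
        map_one, one_mul, inv_one, mul_one] at h
      have h' := congrArg (fun v => v.val i j) h
      simpa [mapMatrixUnits_apply, FiniteField.coe_frobeniusAlgEquivOfAlgebraic,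
        frobenius_def] using h'
    intro g₁ g₂ h₁ h₂
    exact Subtype.ext (commute_of_apply_frobenius_eq 2 g₁.2 g₂.2
      (key g₁ fun y => congrArg Subtype.val (h₁ y))
      (key g₂ fun y => congrArg Subtype.val (h₂ y))).eq
end

section
/- The K-dimension of L_{p,1} equals 2(p−1), and for every k ≥ 2 the K-dimension of L_{p,k} equals (p−1) · C(k+p−3, k−1), where C(·,·) denotes the binomial coefficient. -/
namespace Paper

variable (K : Type) [Field K] (p : ℕ)

abbrev Idx (p : ℕ) : Type := (ZMod p)ˣ ⊕ (ZMod p)ˣ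

/-- The Lie ideal of the free Lie algebra generated by the `v`-generators. -/
noncomputable def vIdealFree : LieIdeal K (FreeLieAlgebra K (Idx p)) :=
  LieSubmodule.lieSpan K _ (Set.range fun i => FreeLieAlgebra.of K (Sum.inr i : Idx p))

noncomputable def rels : Set (FreeLieAlgebra K (Idx p)) :=
  { z : FreeLieAlgebra K (Idx p) | ∃ i j : (ZMod p)ˣ,
      z = ⁅FreeLieAlgebra.of K (Sum.inl i : Idx p), FreeLieAlgebra.of K (Sum.inl j : Idx p)⁆ } ∪
  { z : FreeLieAlgebra K (Idx p) | ∃ u ∈ vIdealFree K p, ∃ w ∈ vIdealFree K p, z = ⁅u, w⁆ }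

noncomputable def relIdeal : LieIdeal K (FreeLieAlgebra K (Idx p)) :=
  LieSubmodule.lieSpan K _ (rels K p)

abbrev Lp : Type := FreeLieAlgebra K (Idx p) ⧸ relIdeal K p

noncomputable def gen (x : Idx p) : Lp K p :=
  LieSubmodule.Quotient.mk (N := relIdeal K p) (FreeLieAlgebra.of K x)

noncomputable def aGen (i : (ZMod p)ˣ) : Lp K p := gen K p (Sum.inl i)
noncomputable def vGen (i : (ZMod p)ˣ) : Lp K p := gen K p (Sum.inr i)

/-- Left-normed bracket `[x, l₁, l₂, …]` in the generators. -/
noncomputable def lnb (x : Idx p) (l : List (Idx p)) : Lp K p :=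
  l.foldl (fun b y => ⁅b, gen K p y⁆) (gen K p x)

/-- Degree-`k` homogeneous component: the span of left-normed brackets of length `k`. -/
noncomputable def homog (k : ℕ) : Submodule K (Lp K p) :=
  Submodule.span K { z | ∃ x l, l.length + 1 = k ∧ z = lnb K p x l }

/-- Fixed-point subspace of a Lie algebra automorphism. -/
noncomputable def fixedSubmodule (e : Lp K p ≃ₗ⁅K⁆ Lp K p) : Submodule K (Lp K p) where
  carrier := { x | e x = x }
  add_mem' := by
    intro a b ha hb
    simp only [Set.mem_setOf_eq] at *
    rw [show e (a + b) = e a + e b from map_add e.toLinearEquiv a b, ha, hb]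
  zero_mem' := by
    simp only [Set.mem_setOf_eq]
    rw [show e 0 = 0 from map_zero e.toLinearEquiv]
  smul_mem' := by
    intro c a ha
    simp only [Set.mem_setOf_eq] at *
    rw [show e (c • a) = c • e a from map_smul e.toLinearEquiv c a, ha]

/-- Eigenspace of a Lie algebra automorphism for the eigenvalue `c`. -/
noncomputable def eigSp (e : Lp K p ≃ₗ⁅K⁆ Lp K p) (c : K) : Submodule K (Lp K p) where
  carrier := { x | e x = c • x }
  add_mem' := by
    intro a b ha hb
    simp only [Set.mem_setOf_eq] at *
    rw [show e (a + b) = e a + e b from map_add e.toLinearEquiv a b, ha, hb, smul_add]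
  zero_mem' := by
    simp only [Set.mem_setOf_eq]
    rw [show e 0 = 0 from map_zero e.toLinearEquiv, smul_zero]
  smul_mem' := by
    intro d a ha
    simp only [Set.mem_setOf_eq] at *
    rw [show e (d • a) = d • e a from map_smul e.toLinearEquiv d a, ha, smul_comm]


/-- The module `R × R` carrying the Lie bracket of the semidirect product of the abelian Lie
algebra `R` with the module `R` on which it acts by multiplication from the right. -/
def AffineLie (R : Type) : Type := R × R

namespace AffineLie

variable {R : Type}

/-- The element with the given coordinates. -/
def mk (a b : R) : AffineLie R := (a, b)

@[simp] lemma fst_mk (a b : R) : (mk a b).1 = a := rfl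
@[simp] lemma snd_mk (a b : R) : (mk a b).2 = b := rfl

@[ext] lemma ext {x y : AffineLie R} (h₁ : x.1 = y.1) (h₂ : x.2 = y.2) : x = y := Prod.ext h₁ h₂

variable [CommRing R]

noncomputable instance : AddCommGroup (AffineLie R) := inferInstanceAs (AddCommGroup (R × R))

instance [Algebra K R] : Module K (AffineLie R) := inferInstanceAs (Module K (R × R))

instance : Bracket (AffineLie R) (AffineLie R) := ⟨fun x y => mk 0 (x.2 * y.1 - y.2 * x.1)⟩

@[simp] lemma fst_zero : (0 : AffineLie R).1 = 0 := rfl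
@[simp] lemma snd_zero : (0 : AffineLie R).2 = 0 := rfl
@[simp] lemma fst_add (x y : AffineLie R) : (x + y).1 = x.1 + y.1 := rfl
@[simp] lemma snd_add (x y : AffineLie R) : (x + y).2 = x.2 + y.2 := rfl
@[simp] lemma fst_smul [Algebra K R] (c : K) (x : AffineLie R) : (c • x).1 = c • x.1 := rfl
@[simp] lemma snd_smul [Algebra K R] (c : K) (x : AffineLie R) : (c • x).2 = c • x.2 := rfl
@[simp] lemma fst_lie (x y : AffineLie R) : ⁅x, y⁆.1 = 0 := rfl
@[simp] lemma snd_lie (x y : AffineLie R) : ⁅x, y⁆.2 = x.2 * y.1 - y.2 * x.1 := rfl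

noncomputable instance : LieRing (AffineLie R) where
  add_lie x y z := by ext <;> simp; ring
  lie_add x y z := by ext <;> simp; ring
  lie_self x := by ext <;> simp
  leibniz_lie x y z := by ext <;> simp; ring

noncomputable instance [Algebra K R] : LieAlgebra K (AffineLie R) where
  lie_smul c x y := by ext <;> simp [smul_sub]

/-- The sum of the two coordinates. -/
def coordSum [Algebra K R] : AffineLie R →ₗ[K] R where
  toFun x := x.1 + x.2
  map_add' x y := by simp; ring
  map_smul' c x := by simp

variable (R) in
/-- The ideal of elements whose first coordinate vanishes. -/
def sndIdeal [Algebra K R] : LieIdeal K (AffineLie R) where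
  carrier := {x | x.1 = 0}
  add_mem' {x y} hx hy := by simp_all
  zero_mem' := rfl
  smul_mem' c x hx := by simp_all
  lie_mem {x y} _ := fst_lie x y

lemma lie_eq_zero_of_fst {x y : AffineLie R} (hx : x.1 = 0) (hy : y.1 = 0) : ⁅x, y⁆ = 0 := by
  ext <;> simp [hx, hy]

end AffineLie

/-- Images of the generators in the polynomial model. -/
noncomputable def modelGen : Idx p → AffineLie (MvPolynomial (Idx p) K)
  | .inl i => .mk (MvPolynomial.X (.inl i)) 0
  | .inr i => .mk 0 (MvPolynomial.X (.inr i))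

noncomputable def freeToModel :
    FreeLieAlgebra K (Idx p) →ₗ⁅K⁆ AffineLie (MvPolynomial (Idx p) K) :=
  FreeLieAlgebra.lift K (modelGen K p)

lemma vIdealFree_le_comap :
    vIdealFree K p ≤ (AffineLie.sndIdeal K (MvPolynomial (Idx p) K)).comap (freeToModel K p) := by
  refine LieSubmodule.lieSpan_le.mpr ?_
  rintro _ ⟨i, rfl⟩
  rw [SetLike.mem_coe, LieIdeal.mem_comap, freeToModel, FreeLieAlgebra.lift_of_apply]
  rfl

lemma relIdeal_le_ker : relIdeal K p ≤ (freeToModel K p).ker := by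
  refine LieSubmodule.lieSpan_le.mpr ?_
  rintro _ (⟨i, j, rfl⟩ | ⟨u, hu, w, hw, rfl⟩) <;>
    rw [SetLike.mem_coe, LieHom.mem_ker, LieHom.map_lie]
  · simp only [freeToModel, FreeLieAlgebra.lift_of_apply]
    ext1 <;> simp [modelGen]
  · exact AffineLie.lie_eq_zero_of_fst
      (vIdealFree_le_comap K p hu) (vIdealFree_le_comap K p hw)

/-- The comparison map from `Lp` to the polynomial model. -/
noncomputable def toModel : Lp K p →ₗ[K] AffineLie (MvPolynomial (Idx p) K) :=
  (relIdeal K p).toSubmodule.liftQ (freeToModel K p).toLinearMap fun _ h => relIdeal_le_ker K p h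

lemma toModel_gen (x : Idx p) : toModel K p (gen K p x) = modelGen K p x :=
  FreeLieAlgebra.lift_of_apply (R := K) (modelGen K p) x

lemma toModel_lie (x y : Lp K p) : toModel K p ⁅x, y⁆ = ⁅toModel K p x, toModel K p y⁆ := by
  obtain ⟨x, rfl⟩ := LieSubmodule.Quotient.surjective_mk' _ x
  obtain ⟨y, rfl⟩ := LieSubmodule.Quotient.surjective_mk' _ y
  exact (freeToModel K p).map_lie x y

lemma aGen_lie_aGen (i j : (ZMod p)ˣ) : ⁅aGen K p i, aGen K p j⁆ = 0 := by
  refine (LieSubmodule.Quotient.mk_eq_zero' (N := relIdeal K p)).mpr ?_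
  exact LieSubmodule.subset_lieSpan (Or.inl ⟨i, j, rfl⟩)

lemma mk_lie_mk_of_mem {u w : FreeLieAlgebra K (Idx p)} (hu : u ∈ vIdealFree K p)
    (hw : w ∈ vIdealFree K p) :
    ⁅(LieSubmodule.Quotient.mk u : Lp K p), (LieSubmodule.Quotient.mk w : Lp K p)⁆ = 0 := by
  refine (LieSubmodule.Quotient.mk_eq_zero' (N := relIdeal K p)).mpr ?_
  exact LieSubmodule.subset_lieSpan (Or.inr ⟨u, hu, w, hw, rfl⟩)

lemma of_inr_mem_vIdealFree (i : (ZMod p)ˣ) :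
    FreeLieAlgebra.of K (Sum.inr i : Idx p) ∈ vIdealFree K p :=
  LieSubmodule.subset_lieSpan ⟨i, rfl⟩

instance : RightCommutative fun (b : Lp K p) (j : (ZMod p)ˣ) => ⁅b, aGen K p j⁆ where
  right_comm b i j := by
    have h := lie_lie b (aGen K p i) (aGen K p j)
    rw [aGen_lie_aGen, lie_zero] at h
    rw [lie_lie, aGen_lie_aGen, lie_zero, zero_sub, ← lie_skew, neg_neg]

/-- The bracket `[v_i, a_{j₁}, …, a_{jₙ}]`, which depends only on the multiset of the `j`s. -/
noncomputable def vaBracket (i : (ZMod p)ˣ) (m : Multiset (ZMod p)ˣ) : Lp K p :=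
  m.foldl (fun b j => ⁅b, aGen K p j⁆) (vGen K p i)

lemma vaBracket_cons (i j : (ZMod p)ˣ) (m : Multiset (ZMod p)ˣ) :
    vaBracket K p i (j ::ₘ m) = ⁅vaBracket K p i m, aGen K p j⁆ := by
  rw [← Multiset.singleton_add, add_comm, vaBracket, Multiset.foldl_add]
  rfl

lemma exists_vaBracket_eq_mk (i : (ZMod p)ˣ) (m : Multiset (ZMod p)ˣ) :
    ∃ u ∈ vIdealFree K p, vaBracket K p i m = LieSubmodule.Quotient.mk u := by
  induction m using Multiset.induction_on with
  | empty => exact ⟨_, of_inr_mem_vIdealFree K p i, rfl⟩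
  | cons j m ih =>
    obtain ⟨u, hu, h⟩ := ih
    refine ⟨⁅u, FreeLieAlgebra.of K (.inl j)⁆, lie_mem_left K _ _ _ _ hu, ?_⟩
    rw [vaBracket_cons, h]
    rfl

lemma vaBracket_lie_vGen (i j : (ZMod p)ˣ) (m : Multiset (ZMod p)ˣ) :
    ⁅vaBracket K p i m, vGen K p j⁆ = 0 := by
  obtain ⟨u, hu, h⟩ := exists_vaBracket_eq_mk K p i m
  rw [h]
  exact mk_lie_mk_of_mem K p hu (of_inr_mem_vIdealFree K p j)

lemma toModel_vaBracket (i : (ZMod p)ˣ) (m : Multiset (ZMod p)ˣ) :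
    toModel K p (vaBracket K p i m) = .mk 0 (MvPolynomial.monomial
      (Multiset.toFinsupp (Sum.inr i ::ₘ m.map Sum.inl)) 1) := by
  classical
  induction m using Multiset.induction_on with
  | empty =>
    refine (toModel_gen K p _).trans ?_
    simp [modelGen, MvPolynomial.X]
  | cons j m ih =>
    rw [vaBracket_cons, toModel_lie, ih, aGen, toModel_gen]
    refine AffineLie.ext rfl ?_
    rw [AffineLie.snd_lie, modelGen, AffineLie.fst_mk, AffineLie.snd_mk, AffineLie.snd_mk,
      MvPolynomial.X, zero_mul, sub_zero, MvPolynomial.monomial_mul, Multiset.map_cons,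
      Multiset.cons_swap, ← Multiset.singleton_add (Sum.inl j), map_add,
      Multiset.toFinsupp_singleton, add_comm, one_mul, AffineLie.snd_mk]

lemma linearIndependent_vaBracket (n : ℕ) :
    LinearIndependent K fun q : (ZMod p)ˣ × Sym (ZMod p)ˣ n => vaBracket K p q.1 q.2 := by
  classical
  let e : (ZMod p)ˣ × Sym (ZMod p)ˣ n → (Idx p →₀ ℕ) := fun q =>
    Multiset.toFinsupp (Sum.inr q.1 ::ₘ (q.2 : Multiset (ZMod p)ˣ).map Sum.inl)
  have he : Function.Injective e := by
    rintro ⟨i, m⟩ ⟨j, m'⟩ h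
    have h := Multiset.toFinsupp.injective h
    have hij : i = j := by
      have hi : (Sum.inr i : Idx p) ∈ Sum.inr j ::ₘ (m' : Multiset (ZMod p)ˣ).map Sum.inl :=
        h ▸ Multiset.mem_cons_self _ _
      simpa using hi
    subst hij
    have hm := Multiset.map_injective Sum.inl_injective ((Multiset.cons_inj_right _).mp h)
    exact congrArg (Prod.mk i) (Sym.coe_injective hm)
  refine LinearIndependent.of_comp (AffineLie.coordSum K ∘ₗ toModel K p) ?_
  have h : (AffineLie.coordSum K ∘ₗ toModel K p) ∘
      (fun q : (ZMod p)ˣ × Sym (ZMod p)ˣ n => vaBracket K p q.1 q.2) =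
        MvPolynomial.basisMonomials (Idx p) K ∘ e := by
    ext1 q
    simp only [Function.comp_apply, LinearMap.comp_apply, toModel_vaBracket,
      MvPolynomial.coe_basisMonomials]
    exact zero_add _
  exact h ▸ (MvPolynomial.basisMonomials (Idx p) K).linearIndependent.comp e he

lemma linearIndependent_gen : LinearIndependent K (gen K p) := by
  refine LinearIndependent.of_comp (AffineLie.coordSum K ∘ₗ toModel K p) ?_
  have h : (AffineLie.coordSum K ∘ₗ toModel K p) ∘ gen K p =
      MvPolynomial.basisMonomials (Idx p) K ∘ fun x => Finsupp.single x 1 := by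
    ext1 x
    simp only [Function.comp_apply, LinearMap.comp_apply, toModel_gen,
      MvPolynomial.coe_basisMonomials]
    cases x
    · exact add_zero _
    · exact zero_add _
  exact h ▸ (MvPolynomial.basisMonomials (Idx p) K).linearIndependent.comp _
    (Finsupp.single_left_injective one_ne_zero)

lemma homog_one : homog K p 1 = Submodule.span K (Set.range (gen K p)) := by
  refine congrArg (Submodule.span K) (Set.ext fun z => ⟨?_, ?_⟩)
  · rintro ⟨x, l, hl, rfl⟩
    obtain rfl := List.length_eq_zero_iff.mp (Nat.succ_injective hl)
    exact ⟨x, rfl⟩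
  · rintro ⟨x, rfl⟩
    exact ⟨x, [], rfl, rfl⟩

lemma lnb_mem_span (x : Idx p) (l : List (Idx p)) (hl : l ≠ []) :
    lnb K p x l ∈ Submodule.span K (Set.range
      fun q : (ZMod p)ˣ × Sym (ZMod p)ˣ l.length => vaBracket K p q.1 q.2) := by
  have key (i : (ZMod p)ˣ) (m : Multiset (ZMod p)ˣ) (n : ℕ) (hm : m.card = n) :
      vaBracket K p i m ∈ Submodule.span K (Set.range
        fun q : (ZMod p)ˣ × Sym (ZMod p)ˣ n => vaBracket K p q.1 q.2) :=
    Submodule.subset_span ⟨(i, ⟨m, hm⟩), rfl⟩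
  induction l using List.reverseRecOn with
  | nil => exact absurd rfl hl
  | append_singleton l y ih =>
    have hstep : lnb K p x (l ++ [y]) = ⁅lnb K p x l, gen K p y⁆ := by
      simp [lnb]
    rw [hstep, List.length_append, List.length_singleton]
    obtain rfl | hne := eq_or_ne l []
    · obtain i | i := x <;> obtain j | j := y
      · exact (aGen_lie_aGen K p i j).symm ▸ zero_mem _
      · have h := key j {i} 1 rfl
        have hji : ⁅aGen K p i, vGen K p j⁆ = -vaBracket K p j {i} := (lie_skew _ _).symm
        exact hji.symm ▸ neg_mem h
      · exact key i {j} 1 rfl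
      · exact (vaBracket_lie_vGen K p i j 0).symm ▸ zero_mem _
    · refine Submodule.span_induction ?_ (by simp) (fun u w _ _ hu hw => ?_)
        (fun c u _ hu => ?_) (ih hne)
      · rintro _ ⟨⟨i, m, hm⟩, rfl⟩
        obtain j | j := y
        · exact vaBracket_cons K p i j m ▸ key i (j ::ₘ m) _ (by simp [hm])
        · exact (vaBracket_lie_vGen K p i j m).symm ▸ zero_mem _
      · exact add_lie u w (gen K p y) ▸ add_mem hu hw
      · exact smul_lie c u (gen K p y) ▸ Submodule.smul_mem _ c hu

lemma vaBracket_coe (i : (ZMod p)ˣ) (l : List (ZMod p)ˣ) :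
    vaBracket K p i l = lnb K p (.inr i) (l.map .inl) := by
  simp only [vaBracket, Multiset.coe_foldl, lnb, List.foldl_map]
  rfl

lemma homog_succ {n : ℕ} (hn : n ≠ 0) :
    homog K p (n + 1) = Submodule.span K (Set.range
      fun q : (ZMod p)ˣ × Sym (ZMod p)ˣ n => vaBracket K p q.1 q.2) := by
  refine le_antisymm (Submodule.span_le.mpr ?_) (Submodule.span_mono ?_)
  · rintro _ ⟨x, l, hl, rfl⟩
    obtain rfl := Nat.succ_injective hl
    exact lnb_mem_span K p x l fun h => hn (List.length_eq_zero_iff.mpr h)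
  · rintro _ ⟨⟨i, m, hm⟩, rfl⟩
    induction m using Quotient.inductionOn with
    | h l => exact ⟨.inr i, l.map .inl, by simpa using hm, vaBracket_coe K p i l⟩

/-- **Proposition 2.2.** `dim L_{p,1} = 2(p−1)` and `dim L_{p,k} = (p−1)·C(k+p−3, k−1)` for all
`k ≥ 2`. -/
theorem finrank_homog (K : Type) [Field K] (p : ℕ) [Fact p.Prime]
    (hchar : ¬ (ringChar K ∣ p)) (ω : K) (hω : IsPrimitiveRoot ω p) :
    Module.finrank K (homog K p 1) = 2 * (p - 1) ∧
    ∀ k : ℕ, 2 ≤ k →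
      Module.finrank K (homog K p k) = (p - 1) * Nat.choose (k + p - 3) (k - 1) := by
  have hcard : Fintype.card (ZMod p)ˣ = p - 1 := by
    rw [ZMod.card_units_eq_totient, Nat.totient_prime Fact.out]
  have hp : 2 ≤ p := Nat.Prime.two_le Fact.out
  refine ⟨?_, fun k hk => ?_⟩
  · rw [homog_one, finrank_span_eq_card (linearIndependent_gen K p), Fintype.card_sum, hcard,
      two_mul]
  · obtain ⟨n, rfl⟩ : ∃ n, k = n + 1 := ⟨k - 1, by omega⟩
    rw [homog_succ K p (by omega), finrank_span_eq_card (linearIndependent_vaBracket K p n),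
      Fintype.card_prod, Sym.card_sym_eq_multichoose, hcard, Nat.multichoose_eq]
    congr 2
    omega

end Paper
end

section
/- There exist Lie algebra automorphisms f and h of L_p such that f(a_i) = ω^i a_i and f(v_i) = ω^i v_i for all 1 ≤ i ≤ p−1, and h(a_i) = a_{ri mod p} and h(v_i) = v_{ri mod p} for all 1 ≤ i ≤ p−1; moreover f has order exactly p, h has order exactly p−1, and h^{−1} ∘ f ∘ h = f^r. Consequently the subgroup of Aut(L_p) generated by f and h is a Frobenius group with cyclic kernel of order p generated by f and cyclic complement of order p−1 generated by h. -/
namespace Paper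

variable (K : Type) [Field K] (p : ℕ)

section MetacyclicGroup

variable {G : Type*} [Group G] {p : ℕ} [Fact p.Prime] {F H : G} {r : (ZMod p)ˣ}

theorem pow_eq_pow_iff_natCast_eq (hF : orderOf F = p) (a b : ℕ) :
    F ^ a = F ^ b ↔ (a : ZMod p) = b := by
  rw [pow_eq_pow_iff_modEq, hF, ZMod.natCast_eq_natCast_iff]

theorem orderOf_units_of_zpowers_eq_top (hr : Subgroup.zpowers r = ⊤) : orderOf r = p - 1 := by
  rw [← Nat.card_zpowers, hr, Subgroup.card_top, Nat.card_eq_fintype_card, ZMod.card_units]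

theorem inv_pow_mul_mul_pow (hF : orderOf F = p) (hc : H⁻¹ * F * H = F ^ (r : ZMod p).val)
    (n m : ℕ) : (H ^ n)⁻¹ * F ^ m * H ^ n = F ^ (((r ^ n : (ZMod p)ˣ) : ZMod p).val * m) := by
  have hc' (m : ℕ) : H⁻¹ * F ^ m * H = F ^ ((r : ZMod p).val * m) := by
    rw [pow_mul, ← hc]
    simpa using (conj_pow (a := H⁻¹) (b := F) (i := m)).symm
  induction n with
  | zero =>
    simp only [pow_zero, inv_one, one_mul, mul_one]
    rw [pow_eq_pow_iff_natCast_eq hF]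
    simp
  | succ n ih =>
    calc (H ^ (n + 1))⁻¹ * F ^ m * H ^ (n + 1)
        = H⁻¹ * ((H ^ n)⁻¹ * F ^ m * H ^ n) * H := by
          rw [pow_succ, mul_inv_rev]; group
      _ = _ := by
          rw [ih, hc', pow_eq_pow_iff_natCast_eq hF]
          simp [pow_succ]
          ring

theorem exists_eq_pow_mul_pow_of_mem_closure_pair (hF : orderOf F = p) (hH : IsOfFinOrder H)
    (hc : H⁻¹ * F * H = F ^ (r : ZMod p).val) {g : G}
    (hg : g ∈ Subgroup.closure ({F, H} : Set G)) : ∃ m n : ℕ, g = F ^ m * H ^ n := by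
  have hFfin : IsOfFinOrder F :=
    orderOf_pos_iff.mp (hF ▸ (Fact.out : p.Prime).pos)
  have hFinv : ∃ k : ℕ, F ^ k = F⁻¹ :=
    hFfin.mem_powers_iff_mem_zpowers.mpr (inv_mem (Subgroup.mem_zpowers F))
  have hHinv : ∃ k : ℕ, H ^ k = H⁻¹ :=
    hH.mem_powers_iff_mem_zpowers.mpr (inv_mem (Subgroup.mem_zpowers H))
  obtain ⟨k, hk⟩ := hFinv
  obtain ⟨l, hl⟩ := hHinv
  have hswap (n m : ℕ) : ∃ m' : ℕ, (H ^ n)⁻¹ * F ^ m = F ^ m' * (H ^ n)⁻¹ :=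
    ⟨_, by rw [← inv_pow_mul_mul_pow hF hc n m, mul_inv_cancel_right]⟩
  induction hg using Subgroup.closure_induction_left with
  | one => exact ⟨0, 0, by simp⟩
  | mul_left x hx y _ ih =>
    obtain ⟨m, n, rfl⟩ := ih
    obtain rfl | rfl := hx
    · exact ⟨m + 1, n, by rw [pow_succ', mul_assoc]⟩
    · obtain ⟨m', h⟩ := hswap l m
      rw [hl, inv_inv] at h
      exact ⟨m', n + 1, by rw [← mul_assoc, h, pow_succ', mul_assoc]⟩
  | inv_mul_cancel x hx y _ ih =>
    obtain ⟨m, n, rfl⟩ := ih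
    obtain rfl | rfl := hx
    · exact ⟨k + m, n, by rw [pow_add, hk, mul_assoc]⟩
    · obtain ⟨m', h⟩ := hswap 1 m
      rw [pow_one] at h
      exact ⟨m', l + n, by rw [← mul_assoc, h, pow_add, hl, mul_assoc]⟩

theorem zpowers_inf_zpowers_eq_bot (hF : orderOf F = p) (hH : orderOf H = p - 1) :
    Subgroup.zpowers F ⊓ Subgroup.zpowers H = ⊥ := by
  apply disjoint_iff.mp
  apply Subgroup.disjoint_of_coprime_natCard
  rw [Nat.card_zpowers, Nat.card_zpowers, hF, hH]
  have hp := (Fact.out : p.Prime).one_lt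
  exact (Nat.coprime_self_sub_right hp.le).mpr (Nat.coprime_one_right p)

theorem conj_mem_zpowers (hF : orderOf F = p) (hH : IsOfFinOrder H)
    (hc : H⁻¹ * F * H = F ^ (r : ZMod p).val) {g t : G}
    (hg : g ∈ Subgroup.zpowers F) (ht : t ∈ Subgroup.zpowers H) :
    t⁻¹ * g * t ∈ Subgroup.zpowers F := by
  have hFfin : IsOfFinOrder F :=
    orderOf_pos_iff.mp (hF ▸ (Fact.out : p.Prime).pos)
  obtain ⟨m, rfl⟩ := hFfin.mem_powers_iff_mem_zpowers.mpr hg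
  obtain ⟨n, rfl⟩ := hH.mem_powers_iff_mem_zpowers.mpr ht
  simp only [inv_pow_mul_mul_pow hF hc]
  exact Subgroup.npow_mem_zpowers F _

theorem eq_one_of_commute_of_mem_zpowers (hF : orderOf F = p) (hH : IsOfFinOrder H)
    (hHr : orderOf H = orderOf r)
    (hc : H⁻¹ * F * H = F ^ (r : ZMod p).val) {g t : G}
    (ht : t ∈ Subgroup.zpowers H) (ht1 : t ≠ 1) (hg : g ∈ Subgroup.zpowers F)
    (hgt : Commute g t) : g = 1 := by
  have hFfin : IsOfFinOrder F :=
    orderOf_pos_iff.mp (hF ▸ (Fact.out : p.Prime).pos)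
  obtain ⟨m, rfl⟩ := hFfin.mem_powers_iff_mem_zpowers.mpr hg
  obtain ⟨n, rfl⟩ := hH.mem_powers_iff_mem_zpowers.mpr ht
  have h := inv_pow_mul_mul_pow hF hc n m
  have hgt' : F ^ m * H ^ n = H ^ n * F ^ m := hgt
  rw [mul_assoc, hgt', inv_mul_cancel_left, pow_eq_pow_iff_natCast_eq hF] at h
  rw [Nat.cast_mul, ZMod.natCast_zmod_val, eq_comm, mul_left_eq_self₀] at h
  obtain h | h := h
  · refine absurd ?_ ht1
    change H ^ n = 1
    rw [← orderOf_dvd_iff_pow_eq_one, hHr, orderOf_dvd_iff_pow_eq_one]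
    exact Units.ext h
  · change F ^ m = 1
    rw [← pow_zero F, pow_eq_pow_iff_natCast_eq hF, h, Nat.cast_zero]

end MetacyclicGroup

namespace Lp

variable {K : Type} [Field K] {p : ℕ}

section Lift

variable {M : Type*} [LieRing M] [LieAlgebra K M]

/-- The Lie algebra map out of `Lp K p` induced by a map on generators that respects the
relations. -/
noncomputable def lift (g : Idx p → M) (hg : relIdeal K p ≤ (FreeLieAlgebra.lift K g).ker) :
    Lp K p →ₗ⁅K⁆ M :=
  { (relIdeal K p).toSubmodule.liftQ (FreeLieAlgebra.lift K g : FreeLieAlgebra K (Idx p) →ₗ[K] M)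
      (fun _ hx => hg hx) with
    map_lie' := by
      intro x y
      induction x using Submodule.Quotient.induction_on
      induction y using Submodule.Quotient.induction_on
      exact (FreeLieAlgebra.lift K g).map_lie _ _ }

@[simp]
theorem lift_gen (g : Idx p → M) (hg : relIdeal K p ≤ (FreeLieAlgebra.lift K g).ker)
    (x : Idx p) : lift g hg (gen K p x) = g x :=
  FreeLieAlgebra.lift_of_apply g x

/-- The quotient map from the free Lie algebra onto `Lp K p`. -/
noncomputable def mkHom : FreeLieAlgebra K (Idx p) →ₗ⁅K⁆ Lp K p :=
  { (relIdeal K p).toSubmodule.mkQ with map_lie' := rfl }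

theorem mkHom_of (x : Idx p) : mkHom (FreeLieAlgebra.of K x) = gen K p x := rfl

theorem mkHom_eq_zero {z : FreeLieAlgebra K (Idx p)} : mkHom z = 0 ↔ z ∈ relIdeal K p :=
  Submodule.Quotient.mk_eq_zero _

theorem mkHom_surjective : Function.Surjective (mkHom (K := K) (p := p)) :=
  Submodule.Quotient.mk_surjective _

theorem hom_ext {φ ψ : Lp K p →ₗ⁅K⁆ M} (h : ∀ x, φ (gen K p x) = ψ (gen K p x)) : φ = ψ := by
  have h' : φ.comp mkHom = ψ.comp mkHom := FreeLieAlgebra.hom_ext h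
  ext x
  obtain ⟨x, rfl⟩ := mkHom_surjective x
  exact LieHom.congr_fun h' x

theorem relIdeal_le_ker_of_isLieAbelian [IsLieAbelian M] (g : Idx p → M) :
    relIdeal K p ≤ (FreeLieAlgebra.lift K g).ker := by
  refine LieSubmodule.lieSpan_le.mpr ?_
  rintro _ (⟨i, j, rfl⟩ | ⟨u, -, w, -, rfl⟩) <;>
  simp [LieHom.mem_ker, trivial_lie_zero M M]

end Lift

theorem linearIndependent_gen : LinearIndependent K (gen K p) := by
  let _ : LieRing (Idx p → K) := LieRing.ofAssociativeRing
  let _ : LieAlgebra K (Idx p → K) := LieAlgebra.ofAssociativeAlgebra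
  have : IsLieAbelian (Idx p → K) := ⟨fun x y => by
    rw [LieRing.of_associative_ring_bracket, mul_comm, sub_self]⟩
  classical
  let φ : Lp K p →ₗ⁅K⁆ (Idx p → K) :=
    lift (fun x => Pi.single x 1) (relIdeal_le_ker_of_isLieAbelian _)
  refine LinearIndependent.of_comp (φ : Lp K p →ₗ[K] (Idx p → K)) ?_
  have : (φ : Lp K p →ₗ[K] (Idx p → K)) ∘ gen K p = fun x => Pi.single x 1 :=
    funext fun x => lift_gen _ _ x
  rw [this]
  exact Pi.linearIndependent_single_one _ _

section Monomial

variable (c : (ZMod p)ˣ → K) (s : (ZMod p)ˣ → (ZMod p)ˣ)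

/-- The map on generators scaling by `c` and relabelling the indices along `s`. -/
noncomputable def monomialGen : Idx p → Lp K p :=
  Sum.elim (fun i => c i • aGen K p (s i)) (fun i => c i • vGen K p (s i))

theorem exists_mem_vIdealFree_mkHom_eq {u : FreeLieAlgebra K (Idx p)} (hu : u ∈ vIdealFree K p) :
    ∃ u' ∈ vIdealFree K p, mkHom u' = FreeLieAlgebra.lift K (monomialGen c s) u := by
  have hmap : vIdealFree K p ≤
      LieIdeal.comap (FreeLieAlgebra.lift K (monomialGen c s))
        (LieIdeal.map mkHom (vIdealFree K p)) := by
    refine LieSubmodule.lieSpan_le.mpr ?_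
    rintro _ ⟨i, rfl⟩
    change FreeLieAlgebra.lift K (monomialGen c s) (FreeLieAlgebra.of K (Sum.inr i)) ∈
      LieIdeal.map mkHom (vIdealFree K p)
    rw [FreeLieAlgebra.lift_of_apply]
    exact (LieIdeal.map mkHom (vIdealFree K p)).smul_mem (c i) (LieIdeal.mem_map (f := mkHom)
      (LieSubmodule.subset_lieSpan ⟨s i, rfl⟩))
  have := LieIdeal.mem_comap.mp (hmap hu)
  obtain ⟨u', hu'⟩ := LieIdeal.mem_map_of_surjective mkHom_surjective this
  exact ⟨u', u'.2, hu'⟩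

theorem relIdeal_le_ker_monomialGen :
    relIdeal K p ≤ (FreeLieAlgebra.lift K (monomialGen c s)).ker := by
  refine LieSubmodule.lieSpan_le.mpr ?_
  rintro _ (⟨i, j, rfl⟩ | ⟨u, hu, w, hw, rfl⟩)
  · have h : ⁅aGen K p (s i), aGen K p (s j)⁆ = 0 :=
      mkHom_eq_zero.mpr (LieSubmodule.subset_lieSpan (Or.inl ⟨s i, s j, rfl⟩))
    simp [LieHom.mem_ker, monomialGen, h]
  · obtain ⟨u', hu', h⟩ := exists_mem_vIdealFree_mkHom_eq c s hu
    obtain ⟨w', hw', h'⟩ := exists_mem_vIdealFree_mkHom_eq c s hw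
    rw [SetLike.mem_coe, LieHom.mem_ker, LieHom.map_lie, ← h, ← h', ← LieHom.map_lie,
      mkHom_eq_zero]
    exact LieSubmodule.subset_lieSpan (Or.inr ⟨u', hu', w', hw', rfl⟩)

/-- The Lie algebra endomorphism with `a_i ↦ c i • a_{s i}` and `v_i ↦ c i • v_{s i}`. -/
noncomputable def monomialHom : Lp K p →ₗ⁅K⁆ Lp K p :=
  lift (monomialGen c s) (relIdeal_le_ker_monomialGen c s)

theorem monomialHom_aGen (i : (ZMod p)ˣ) :
    monomialHom c s (aGen K p i) = c i • aGen K p (s i) :=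
  lift_gen _ _ _

theorem monomialHom_vGen (i : (ZMod p)ˣ) :
    monomialHom c s (vGen K p i) = c i • vGen K p (s i) :=
  lift_gen _ _ _

end Monomial

section MonomialEquiv

theorem monomialHom_comp_eq_id (c d : (ZMod p)ˣ → K) (s t : (ZMod p)ˣ → (ZMod p)ˣ)
    (hst : ∀ i, t (s i) = i) (hcd : ∀ i, c i * d (s i) = 1) (x : Lp K p) :
    monomialHom d t (monomialHom c s x) = x := by
  have : (monomialHom d t).comp (monomialHom c s) = LieHom.id := by
    refine hom_ext ?_
    rintro (i | i)
    · change monomialHom d t (monomialHom c s (aGen K p i)) = aGen K p i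
      rw [monomialHom_aGen, map_smul, monomialHom_aGen, smul_smul, hcd, hst, one_smul]
    · change monomialHom d t (monomialHom c s (vGen K p i)) = vGen K p i
      rw [monomialHom_vGen, map_smul, monomialHom_vGen, smul_smul, hcd, hst, one_smul]
  exact LieHom.congr_fun this x

/-- The Lie algebra automorphism with `a_i ↦ c i • a_{s i}` and `v_i ↦ c i • v_{s i}`. -/
noncomputable def monomialEquiv (c : (ZMod p)ˣ → Kˣ) (s : Equiv.Perm (ZMod p)ˣ) :
    Lp K p ≃ₗ⁅K⁆ Lp K p :=
  { monomialHom (fun i => (c i : K)) s with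
    invFun := monomialHom (fun i => (((c (s.symm i))⁻¹ : Kˣ) : K)) s.symm
    left_inv := monomialHom_comp_eq_id _ _ _ _ (by simp) (by simp)
    right_inv := monomialHom_comp_eq_id _ _ _ _ (by simp) (by simp) }

variable (c : (ZMod p)ˣ → Kˣ) (s : Equiv.Perm (ZMod p)ˣ)

theorem monomialEquiv_aGen (i : (ZMod p)ˣ) :
    monomialEquiv c s (aGen K p i) = (c i : K) • aGen K p (s i) :=
  monomialHom_aGen _ _ _

theorem monomialEquiv_vGen (i : (ZMod p)ˣ) :
    monomialEquiv c s (vGen K p i) = (c i : K) • vGen K p (s i) :=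
  monomialHom_vGen _ _ _

theorem monomialEquiv_mul (c d : (ZMod p)ˣ → Kˣ) (s t : Equiv.Perm (ZMod p)ˣ) :
    (monomialEquiv c s).toLinearEquiv * (monomialEquiv d t).toLinearEquiv =
      (monomialEquiv (fun i => d i * c (t i)) (s * t)).toLinearEquiv := by
  have : (monomialEquiv c s : Lp K p →ₗ⁅K⁆ Lp K p).comp (monomialEquiv d t) =
      (monomialEquiv (fun i => d i * c (t i)) (s * t) : Lp K p →ₗ⁅K⁆ Lp K p) := by
    refine hom_ext ?_
    rintro (i | i)
    · change monomialEquiv c s (monomialEquiv d t (aGen K p i)) = monomialEquiv _ _ (aGen K p i)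
      simp only [monomialEquiv_aGen, map_smul, smul_smul, Units.val_mul,
        Equiv.Perm.mul_apply]
    · change monomialEquiv c s (monomialEquiv d t (vGen K p i)) = monomialEquiv _ _ (vGen K p i)
      simp only [monomialEquiv_vGen, map_smul, smul_smul, Units.val_mul,
        Equiv.Perm.mul_apply]
  exact LinearEquiv.ext fun x => LieHom.congr_fun this x

theorem monomialEquiv_one : (monomialEquiv (K := K) (p := p) 1 1).toLinearEquiv = 1 := by
  have h := monomialEquiv_mul (K := K) (p := p) 1 1 1 1
  simp only [Pi.one_apply, mul_one] at h
  exact mul_eq_left.mp h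

theorem monomialEquiv_inj {c d : (ZMod p)ˣ → Kˣ} {s t : Equiv.Perm (ZMod p)ˣ}
    (h : (monomialEquiv c s).toLinearEquiv = (monomialEquiv d t).toLinearEquiv) :
    c = d ∧ s = t := by
  have key (i : (ZMod p)ˣ) : s i = t i ∧ c i = d i := by
    have h' : monomialEquiv c s (aGen K p i) = monomialEquiv d t (aGen K p i) :=
      LinearEquiv.congr_fun h _
    rw [monomialEquiv_aGen, monomialEquiv_aGen] at h'
    have hs : s i = t i := Sum.inl_injective
      (linearIndependent_gen.eq_of_smul_apply_eq_smul_apply _ _ _ _ (c i).ne_zero h')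
    rw [hs] at h'
    exact ⟨hs, Units.ext (smul_left_injective K (linearIndependent_gen.ne_zero _) h')⟩
  exact ⟨funext fun i => (key i).2, Equiv.ext fun i => (key i).1⟩

theorem monomialEquiv_pow_one (c : (ZMod p)ˣ → Kˣ) (n : ℕ) :
    (monomialEquiv c 1).toLinearEquiv ^ n = (monomialEquiv (c ^ n) 1).toLinearEquiv := by
  induction n with
  | zero => rw [pow_zero, pow_zero, monomialEquiv_one]
  | succ n ih =>
    rw [pow_succ', ih, monomialEquiv_mul, pow_succ]
    rfl

theorem monomialEquiv_one_pow (s : Equiv.Perm (ZMod p)ˣ) (n : ℕ) :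
    (monomialEquiv (K := K) 1 s).toLinearEquiv ^ n = (monomialEquiv 1 (s ^ n)).toLinearEquiv := by
  induction n with
  | zero => rw [pow_zero, pow_zero, monomialEquiv_one]
  | succ n ih =>
    rw [pow_succ', ih, monomialEquiv_mul, pow_succ']
    simp only [Pi.one_apply, mul_one]
    rfl

end MonomialEquiv

end Lp

/-- There exist Lie algebra automorphisms `f`, `h` of `L_p` with `f(a_i) = ω^i a_i`,
`f(v_i) = ω^i v_i`, `h(a_i) = a_{ri}`, `h(v_i) = v_{ri}`, such that `f` has order `p`, `h` has
order `p−1` and `h⁻¹ ∘ f ∘ h = f^r`; consequently the subgroup of automorphisms generated by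
`f` and `h` is a Frobenius group with cyclic kernel `⟨f⟩` of order `p` and cyclic complement
`⟨h⟩` of order `p−1`.  (The group-theoretic assertions are stated in the automorphism group of
the underlying vector space, via `toLinearEquiv`.) -/
theorem exists_frobenius_automorphisms (K : Type) [Field K] (p : ℕ) [Fact p.Prime]
    (hchar : ¬ (ringChar K ∣ p)) (ω : K) (hω : IsPrimitiveRoot ω p)
    (r : (ZMod p)ˣ) (hr : Subgroup.zpowers r = ⊤) :
    ∃ f h : Lp K p ≃ₗ⁅K⁆ Lp K p,
      (∀ i : (ZMod p)ˣ, f (aGen K p i) = ω ^ ((i : ZMod p)).val • aGen K p i) ∧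
      (∀ i : (ZMod p)ˣ, f (vGen K p i) = ω ^ ((i : ZMod p)).val • vGen K p i) ∧
      (∀ i : (ZMod p)ˣ, h (aGen K p i) = aGen K p (r * i)) ∧
      (∀ i : (ZMod p)ˣ, h (vGen K p i) = vGen K p (r * i)) ∧
      orderOf f.toLinearEquiv = p ∧
      orderOf h.toLinearEquiv = p - 1 ∧
      h.toLinearEquiv⁻¹ * f.toLinearEquiv * h.toLinearEquiv
        = f.toLinearEquiv ^ ((r : ZMod p)).val ∧
      -- the subgroup generated by `f` and `h` is the product `⟨f⟩⟨h⟩` with `⟨f⟩ ∩ ⟨h⟩ = 1` …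
      (∀ g ∈ Subgroup.closure ({f.toLinearEquiv, h.toLinearEquiv} : Set (Lp K p ≃ₗ[K] Lp K p)),
        ∃ m n : ℕ, g = f.toLinearEquiv ^ m * h.toLinearEquiv ^ n) ∧
      Subgroup.zpowers f.toLinearEquiv ⊓ Subgroup.zpowers h.toLinearEquiv = ⊥ ∧
      -- … with `⟨f⟩` normalized by `⟨h⟩` …
      (∀ g ∈ Subgroup.zpowers f.toLinearEquiv, ∀ t ∈ Subgroup.zpowers h.toLinearEquiv,
        t⁻¹ * g * t ∈ Subgroup.zpowers f.toLinearEquiv) ∧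
      -- … and the centralizer in the kernel `⟨f⟩` of every nontrivial element of the
      -- complement `⟨h⟩` is trivial (the Frobenius condition)
      (∀ t ∈ Subgroup.zpowers h.toLinearEquiv, t ≠ 1 →
        ∀ g ∈ Subgroup.zpowers f.toLinearEquiv, Commute g t → g = 1) := by
  have hp : p.Prime := Fact.out
  obtain ⟨w, rfl⟩ := hω.isUnit hp.ne_zero
  have hw : orderOf w = p := by rw [← orderOf_units, ← hω.eq_orderOf]
  let c : (ZMod p)ˣ → Kˣ := fun i => w ^ (i : ZMod p).val
  let s : Equiv.Perm (ZMod p)ˣ := Equiv.mulLeft r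
  let f : Lp K p ≃ₗ⁅K⁆ Lp K p := Lp.monomialEquiv c 1
  let h : Lp K p ≃ₗ⁅K⁆ Lp K p := Lp.monomialEquiv 1 s
  have hF : orderOf f.toLinearEquiv = p := by
    refine orderOf_eq_prime ?_ fun hf => ?_
    · rw [Lp.monomialEquiv_pow_one, ← Lp.monomialEquiv_one]
      congr 2
      funext i
      rw [Pi.pow_apply, pow_right_comm, orderOf_dvd_iff_pow_eq_one.mp hw.dvd, one_pow, Pi.one_apply]
    · have hc := congrFun (Lp.monomialEquiv_inj (hf.trans Lp.monomialEquiv_one.symm)).1 1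
      have := Fact.mk hp.one_lt
      have hw1 : w = 1 := by simpa [c, ZMod.val_one] using hc
      rw [hw1, orderOf_one] at hw
      exact hp.one_lt.ne hw
  have hHr : orderOf h.toLinearEquiv = orderOf r := by
    refine orderOf_eq_orderOf_iff.mpr fun n => ?_
    have hs (m : ℕ) : s ^ m = Equiv.mulLeft (r ^ m) := Equiv.pow_mulLeft r m
    rw [Lp.monomialEquiv_one_pow, hs]
    constructor
    · intro hn
      have := (Lp.monomialEquiv_inj (hn.trans Lp.monomialEquiv_one.symm)).2
      simpa using Equiv.congr_fun this 1
    · intro hn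
      rw [hn, ← Lp.monomialEquiv_one, Equiv.mulLeft_one]
  have hH : orderOf h.toLinearEquiv = p - 1 := hHr.trans (orderOf_units_of_zpowers_eq_top hr)
  have hHfin : IsOfFinOrder h.toLinearEquiv :=
    orderOf_pos_iff.mp (hH ▸ Nat.sub_pos_of_lt hp.one_lt)
  have hc : h.toLinearEquiv⁻¹ * f.toLinearEquiv * h.toLinearEquiv
      = f.toLinearEquiv ^ ((r : ZMod p)).val := by
    rw [mul_assoc, inv_mul_eq_iff_eq_mul, Lp.monomialEquiv_pow_one, Lp.monomialEquiv_mul,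
      Lp.monomialEquiv_mul]
    congr 2
    funext i
    simp only [Pi.one_apply, one_mul, mul_one, Pi.pow_apply, c, s, Equiv.coe_mulLeft, ← pow_mul,
      Units.val_mul]
    rw [pow_eq_pow_iff_natCast_eq hw]
    simp [mul_comm]
  refine ⟨f, h, fun i => ?_, fun i => ?_, fun i => ?_, fun i => ?_, hF, hH, hc,
    fun g hg => exists_eq_pow_mul_pow_of_mem_closure_pair hF hHfin hc hg,
    zpowers_inf_zpowers_eq_bot hF hH,
    fun g hg t ht => conj_mem_zpowers hF hHfin hc hg ht,
    fun t ht ht1 g hg hgt => eq_one_of_commute_of_mem_zpowers hF hHfin hHr hc ht ht1 hg hgt⟩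
  · simpa [c] using Lp.monomialEquiv_aGen c 1 i
  · simpa [c] using Lp.monomialEquiv_vGen c 1 i
  · simpa [s] using Lp.monomialEquiv_aGen (K := K) 1 s i
  · simpa [s] using Lp.monomialEquiv_vGen (K := K) 1 s i

end Paper
end

section
/- Let W'_{p,k} denote the direct sum over j = 1, …, p−1 of the subspaces L_{p,k} ∩ {x ∈ L_p : f(x) = ω^j x}. Then dim_K W'_{p,k} = (p−1) · dim_K(C_{L_p}(h) ∩ W'_{p,k}). -/
namespace Paper

variable (K : Type) [Field K] (p : ℕ)

theorem _root_.iSupIndep.finrank_iSup {𝕜 V ι : Type*} [Field 𝕜] [AddCommGroup V]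
    [Module 𝕜 V] [Fintype ι] {E : ι → Submodule 𝕜 V} [∀ i, Module.Finite 𝕜 (E i)] (hE : iSupIndep E) :
    Module.finrank 𝕜 (⨆ i, E i : Submodule 𝕜 V) = ∑ i, Module.finrank 𝕜 (E i) := by
  classical
  rw [Submodule.iSup_eq_range_dfinsupp_lsum,
    LinearMap.finrank_range_of_inj hE.dfinsupp_lsum_injective]
  exact Module.finrank_directSum (R := 𝕜) (fun i => E i)

section CyclicAction

variable {𝕜 V G : Type*} [Field 𝕜] [AddCommGroup V] [Module 𝕜 V] [Group G]
  {E : G → Submodule 𝕜 V} {T : Module.End 𝕜 V} {r : G}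

theorem pow_apply_mem_of_shift (hTE : ∀ g, ∀ x ∈ E g, T x ∈ E (r * g)) (n : ℕ) {g : G} {x : V}
    (hx : x ∈ E g) : (T ^ n) x ∈ E (r ^ n * g) := by
  induction n with
  | zero => simpa using hx
  | succ n ih => simpa [pow_succ', mul_assoc] using hTE _ _ ih

variable [Fintype G]

theorem bijective_pow_fin_orderOf (hr : Subgroup.zpowers r = ⊤) :
    Function.Bijective (fun n : Fin (orderOf r) => r ^ (n : ℕ)) := by
  refine ⟨fun m n hmn => Fin.ext (pow_injOn_Iio_orderOf m.2 n.2 hmn), fun g => ?_⟩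
  have hg : g ∈ Subgroup.zpowers r := hr ▸ Subgroup.mem_top g
  classical
  obtain ⟨n, hn, rfl⟩ := Finset.mem_image.1 (mem_zpowers_iff_mem_range_orderOf.1 hg)
  exact ⟨⟨n, Finset.mem_range.1 hn⟩, rfl⟩

theorem finrank_eq_finrank_one [∀ g, Module.Finite 𝕜 (E g)] (hr : Subgroup.zpowers r = ⊤)
    (hT : T ^ orderOf r = 1) (hTE : ∀ g, ∀ x ∈ E g, T x ∈ E (r * g)) (g : G) :
    Module.finrank 𝕜 (E g) = Module.finrank 𝕜 (E 1) := by
  have hinj : Function.Injective T := by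
    have hu : IsUnit T := IsUnit.of_pow_eq_one hT (orderOf_pos r).ne'
    exact ((Module.End.isUnit_iff T).1 hu).1
  have key (n : ℕ) (g : G) : Module.finrank 𝕜 (E g) ≤ Module.finrank 𝕜 (E (r ^ n * g)) := by
    have hn : Function.Injective (T ^ n) := by
      rw [Module.End.coe_pow]; exact hinj.iterate n
    refine LinearMap.finrank_le_finrank_of_injective
      (f := (T ^ n).restrict fun x hx => pow_apply_mem_of_shift hTE n hx) fun x y hxy => ?_
    exact Subtype.ext (hn (congrArg Subtype.val hxy))
  obtain ⟨m, hm⟩ := (bijective_pow_fin_orderOf hr).2 g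
  obtain ⟨n, hn⟩ := (bijective_pow_fin_orderOf hr).2 g⁻¹
  apply le_antisymm
  · have := key n g
    rwa [show r ^ (n : ℕ) = g⁻¹ from hn, inv_mul_cancel] at this
  · have := key m 1
    rwa [show r ^ (m : ℕ) = g from hm, mul_one] at this

theorem range_sum_pow_eq_fixed (hE : iSupIndep E) (hr : Subgroup.zpowers r = ⊤)
    (hT : T ^ orderOf r = 1) (hTE : ∀ g, ∀ x ∈ E g, T x ∈ E (r * g)) :
    LinearMap.range ((∑ n : Fin (orderOf r), T ^ (n : ℕ)) ∘ₗ (E 1).subtype) =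
      LinearMap.eqLocus T LinearMap.id ⊓ ⨆ g, E g := by
  ext x
  simp only [LinearMap.mem_range, LinearMap.comp_apply, Submodule.subtype_apply,
    LinearMap.sum_apply, Submodule.mem_inf, LinearMap.mem_eqLocus, LinearMap.id_apply]
  constructor
  · rintro ⟨x, rfl⟩
    constructor
    · rw [← LinearMap.sum_apply, Fin.sum_univ_eq_sum_range (fun n => T ^ n),
        ← Module.End.mul_apply, ← sub_eq_zero, ← LinearMap.sub_apply, ← sub_one_mul,
        mul_geom_sum, hT, sub_self, LinearMap.zero_apply]
    · refine Submodule.sum_mem _ fun n _ => ?_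
      have := pow_apply_mem_of_shift hTE n x.2
      exact Submodule.mem_iSup_of_mem _ this
  · rintro ⟨hx, hxE⟩
    obtain ⟨y, hy, rfl⟩ := (Submodule.mem_iSup_iff_exists_finsupp E x).1 hxE
    rw [Finsupp.sum_fintype _ _ fun _ => rfl] at hx ⊢
    have hstep (g : G) : y (r * g) = T (y g) := by
      have := (iSupIndep_iff_finsetSum_eq_imp_eq E).1 hE Finset.univ y (fun g => T (y (r⁻¹ * g)))
        (fun g _ => ⟨hy g, by simpa using hTE _ _ (hy (r⁻¹ * g))⟩) ?_ (r * g) (Finset.mem_univ _)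
      · simpa using this
      · rw [← hx, map_sum]
        exact (Equiv.sum_comp (Equiv.mulLeft r⁻¹) fun g => T (y g)).symm
    have hpow (n : ℕ) : y (r ^ n) = (T ^ n) (y 1) := by
      induction n with
      | zero => simp
      | succ n ih => rw [pow_succ', hstep, ih, pow_succ', Module.End.mul_apply]
    refine ⟨⟨y 1, hy 1⟩, ?_⟩
    simp only [← hpow]
    exact (bijective_pow_fin_orderOf hr).sum_comp y

theorem finrank_iSup_eq_card_mul_finrank_fixed [∀ g, Module.Finite 𝕜 (E g)] (hE : iSupIndep E)
    (hr : Subgroup.zpowers r = ⊤) (hT : T ^ orderOf r = 1)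
    (hTE : ∀ g, ∀ x ∈ E g, T x ∈ E (r * g)) :
    Module.finrank 𝕜 (⨆ g, E g : Submodule 𝕜 V) = Fintype.card G *
      Module.finrank 𝕜 (LinearMap.eqLocus T LinearMap.id ⊓ ⨆ g, E g : Submodule 𝕜 V) := by
  have hinj : Function.Injective
      ((∑ n : Fin (orderOf r), T ^ (n : ℕ)) ∘ₗ (E 1).subtype) := by
    rw [injective_iff_map_eq_zero]
    intro x hx
    have hind := hE.comp (bijective_pow_fin_orderOf hr).1
    have := (iSupIndep_iff_finsetSum_eq_zero_imp_eq_zero _).1 hind Finset.univ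
      (fun n => (T ^ (n : ℕ)) x) (fun n _ => by simpa using pow_apply_mem_of_shift hTE n x.2)
      (by simpa [LinearMap.sum_apply] using hx) ⟨0, orderOf_pos r⟩ (Finset.mem_univ _)
    simpa using this
  rw [← range_sum_pow_eq_fixed hE hr hT hTE, LinearMap.finrank_range_of_inj hinj,
    hE.finrank_iSup, Finset.sum_congr rfl fun g _ => finrank_eq_finrank_one hr hT hTE g]
  simp

end CyclicAction

variable {K p}

section Generators

variable {M : Type*} [LieRing M] [LieAlgebra K M]

theorem lieHom_ext {F₁ F₂ : Lp K p →ₗ⁅K⁆ M} (h : ∀ x, F₁ (gen K p x) = F₂ (gen K p x)) :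
    F₁ = F₂ := by
  let π : FreeLieAlgebra K (Idx p) →ₗ⁅K⁆ Lp K p :=
    { (LieSubmodule.Quotient.mk' (relIdeal K p) : FreeLieAlgebra K (Idx p) →ₗ[K] Lp K p) with
      map_lie' := rfl }
  have hπ : F₁.comp π = F₂.comp π := FreeLieAlgebra.hom_ext h
  ext x
  obtain ⟨y, rfl⟩ := LieSubmodule.Quotient.surjective_mk' (relIdeal K p) x
  exact LieHom.congr_fun hπ y

end Generators

theorem exists_lieHom_eq_iterate {L : Type*} [LieRing L] [LieAlgebra K L] (e : L ≃ₗ⁅K⁆ L) (n : ℕ) :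
    ∃ F : L →ₗ⁅K⁆ L, ∀ x, F x = e^[n] x := by
  induction n with
  | zero => exact ⟨LieHom.id, fun _ => rfl⟩
  | succ n ih =>
    obtain ⟨F, hF⟩ := ih
    exact ⟨F.comp e.toLieHom, fun x => hF (e x)⟩

instance [NeZero p] (k : ℕ) : Module.Finite K (homog K p k) := by
  refine Module.Finite.span_of_finite K ?_
  have : {z | ∃ x l, l.length + 1 = k ∧ z = lnb K p x l} ⊆
      Set.image2 (lnb K p) Set.univ {l | l.length = k - 1} := by
    rintro _ ⟨x, l, hl, rfl⟩
    exact ⟨x, Set.mem_univ _, l, by simp [← hl], rfl⟩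
  exact (Set.finite_univ.image2 _ (List.finite_length_eq (Idx p) (k - 1))).subset this

section Permutation

variable {e : Lp K p ≃ₗ⁅K⁆ Lp K p} {σ : Idx p → Idx p}

theorem map_lnb (he : ∀ x, e (gen K p x) = gen K p (σ x)) (x : Idx p) (l : List (Idx p)) :
    e (lnb K p x l) = lnb K p (σ x) (l.map σ) := by
  induction l using List.reverseRecOn with
  | nil => exact he x
  | append_singleton l y ih =>
    simp only [lnb, List.map_append, List.foldl_append, List.map_cons, List.map_nil,
      List.foldl_cons, List.foldl_nil] at ih ⊢
    rw [LieEquiv.map_lie, ih, he]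

theorem map_mem_homog (he : ∀ x, e (gen K p x) = gen K p (σ x)) {k : ℕ} {z : Lp K p}
    (hz : z ∈ homog K p k) : e z ∈ homog K p k := by
  have : homog K p k ≤ (homog K p k).comap (e : Lp K p →ₗ[K] Lp K p) := by
    refine Submodule.span_le.2 ?_
    rintro _ ⟨x, l, hl, rfl⟩
    exact Submodule.subset_span ⟨σ x, l.map σ, by simpa using hl, map_lnb he x l⟩
  exact this hz

theorem iterate_gen (he : ∀ x, e (gen K p x) = gen K p (σ x)) (n : ℕ) (x : Idx p) :
    e^[n] (gen K p x) = gen K p (σ^[n] x) := by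
  induction n generalizing x with
  | zero => rfl
  | succ n ih => rw [Function.iterate_succ_apply, he, ih, Function.iterate_succ_apply]

end Permutation

theorem iterate_smul_eigenvector {f : Lp K p ≃ₗ⁅K⁆ Lp K p} {c : K} {z : Lp K p}
    (hz : f z = c • z) (n : ℕ) : f^[n] z = c ^ n • z := by
  induction n with
  | zero => simp
  | succ n ih => rw [Function.iterate_succ_apply', ih, map_smul, hz, smul_smul, pow_succ]

/-- The residue of an index: `i` for both `a_i` and `v_i`. -/
def idxVal (x : Idx p) : (ZMod p)ˣ := Sum.elim id id x

/-- Multiplication of the residue of an index by `r`. -/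
def mulIdx (r : (ZMod p)ˣ) : Idx p → Idx p := Sum.map (r * ·) (r * ·)

theorem iterate_mulIdx (r : (ZMod p)ˣ) (n : ℕ) : (mulIdx r)^[n] = mulIdx (r ^ n) := by
  induction n with
  | zero => funext x; cases x <;> simp [mulIdx]
  | succ n ih =>
    funext x
    rw [Function.iterate_succ_apply, ih]
    cases x <;> simp [mulIdx, pow_succ, mul_assoc]

theorem _root_.IsPrimitiveRoot.pow_val_mul {ω : K} [NeZero p] (hω : IsPrimitiveRoot ω p)
    (a b : ZMod p) : ω ^ (a * b).val = (ω ^ b.val) ^ a.val := by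
  rw [← pow_mul, mul_comm a, ZMod.val_mul, ← pow_eq_pow_mod _ hω.pow_eq_one]

theorem apply_comp_iterate_eq [NeZero p] {ω : K} (hω : IsPrimitiveRoot ω p) {r : (ZMod p)ˣ}
    {f h : Lp K p ≃ₗ⁅K⁆ Lp K p}
    (hf : ∀ x, f (gen K p x) = ω ^ (idxVal x : ZMod p).val • gen K p x)
    (hh : ∀ x, h (gen K p x) = gen K p (mulIdx r x)) (z : Lp K p) :
    f (h z) = h (f^[(r : ZMod p).val] z) := by
  obtain ⟨F, hF⟩ := exists_lieHom_eq_iterate f (r : ZMod p).val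
  have : f.toLieHom.comp h.toLieHom = h.toLieHom.comp F := by
    refine lieHom_ext fun x => ?_
    change f (h _) = h (F _)
    have hr : (idxVal (mulIdx r x) : ZMod p) = r * idxVal x := by cases x <;> rfl
    rw [hF, iterate_smul_eigenvector (hf x), map_smul, hh, hf, hr, hω.pow_val_mul]
  rw [← hF]
  exact LieHom.congr_fun this z

theorem iSup_Icc_eq_iSup_units [Fact p.Prime] {α : Type*} [CompleteLattice α] (F : ℕ → α) :
    ⨆ j ∈ Finset.Icc 1 (p - 1), F j = ⨆ g : (ZMod p)ˣ, F (g : ZMod p).val := by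
  have hp := (Fact.out : p.Prime).pos
  refine le_antisymm (iSup₂_le fun j hj => ?_) (iSup_le fun g => ?_)
  · rw [Finset.mem_Icc] at hj
    have hjp : j < p := by omega
    have hj0 : (j : ZMod p) ≠ 0 := by
      rw [Ne, ZMod.natCast_eq_zero_iff]
      exact Nat.not_dvd_of_pos_of_lt hj.1 hjp
    refine le_trans (le_of_eq ?_) (le_iSup _ (Units.mk0 (j : ZMod p) hj0))
    rw [Units.val_mk0, ZMod.val_natCast_of_lt hjp]
  · have h1 := ZMod.val_lt (g : ZMod p)
    have h2 : 0 < (g : ZMod p).val := ZMod.val_pos.2 g.ne_zero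
    exact le_iSup₂_of_le (g : ZMod p).val (Finset.mem_Icc.2 ⟨h2, by omega⟩) le_rfl

theorem iSupIndep_homog_inf_eigSp [NeZero p] {ω : K} (hω : IsPrimitiveRoot ω p)
    (f : Lp K p ≃ₗ⁅K⁆ Lp K p) (k : ℕ) :
    iSupIndep fun g : (ZMod p)ˣ => homog K p k ⊓ eigSp K p f (ω ^ (g : ZMod p).val) := by
  have hinj : Function.Injective fun g : (ZMod p)ˣ => ω ^ (g : ZMod p).val := fun a b hab =>
    Units.ext (ZMod.val_injective p (hω.pow_inj (ZMod.val_lt _) (ZMod.val_lt _) hab))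
  have hind := (Module.End.eigenspaces_iSupIndep (f : Lp K p →ₗ[K] Lp K p)).comp hinj
  refine hind.mono fun g => inf_le_right.trans fun z hz => ?_
  exact Module.End.mem_eigenspace_iff.2 hz

/-- Let `W'_{p,k}` be the (direct) sum over `j = 1, …, p−1` of the subspaces
`L_{p,k} ∩ {x : f x = ω^j x}`.  Then `dim W'_{p,k} = (p−1) · dim (C_{L_p}(h) ∩ W'_{p,k})`. -/
theorem finrank_W'_eq (K : Type) [Field K] (p : ℕ) [Fact p.Prime]
    (hchar : ¬ (ringChar K ∣ p)) (ω : K) (hω : IsPrimitiveRoot ω p)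
    (r : (ZMod p)ˣ) (hr : Subgroup.zpowers r = ⊤)
    (f h : Lp K p ≃ₗ⁅K⁆ Lp K p)
    (hfa : ∀ i : (ZMod p)ˣ, f (aGen K p i) = ω ^ ((i : ZMod p)).val • aGen K p i)
    (hfv : ∀ i : (ZMod p)ˣ, f (vGen K p i) = ω ^ ((i : ZMod p)).val • vGen K p i)
    (hha : ∀ i : (ZMod p)ˣ, h (aGen K p i) = aGen K p (r * i))
    (hhv : ∀ i : (ZMod p)ˣ, h (vGen K p i) = vGen K p (r * i)) :
    ∀ k : ℕ, 1 ≤ k →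
      Module.finrank K
        (⨆ j ∈ Finset.Icc 1 (p - 1), homog K p k ⊓ eigSp K p f (ω ^ j) : Submodule K (Lp K p))
      = (p - 1) * Module.finrank K
        (fixedSubmodule K p h ⊓
          ⨆ j ∈ Finset.Icc 1 (p - 1), homog K p k ⊓ eigSp K p f (ω ^ j) :
            Submodule K (Lp K p)) := by
  intro k _
  have hf (x : Idx p) : f (gen K p x) = ω ^ (idxVal x : ZMod p).val • gen K p x := by
    cases x <;> [exact hfa _; exact hfv _]
  have hh (x : Idx p) : h (gen K p x) = gen K p (mulIdx r x) := by
    cases x <;> [exact hha _; exact hhv _]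
  have hT : (h : Lp K p →ₗ[K] Lp K p) ^ orderOf r = 1 := by
    obtain ⟨F, hF⟩ := exists_lieHom_eq_iterate h (orderOf r)
    have hFid : F = LieHom.id := lieHom_ext fun x => by
      rw [hF, iterate_gen hh, iterate_mulIdx, pow_orderOf_eq_one]
      cases x <;> simp [mulIdx]
    ext z
    rw [Module.End.pow_apply]
    exact (hF z).symm.trans (by rw [hFid]; rfl)
  have hTE (g : (ZMod p)ˣ) (z : Lp K p)
      (hz : z ∈ homog K p k ⊓ eigSp K p f (ω ^ (g : ZMod p).val)) :
      (h : Lp K p →ₗ[K] Lp K p) z ∈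
        homog K p k ⊓ eigSp K p f (ω ^ ((r * g : (ZMod p)ˣ) : ZMod p).val) := by
    refine ⟨map_mem_homog hh hz.1, ?_⟩
    change f (h z) = _ • h z
    rw [apply_comp_iterate_eq hω hf hh, iterate_smul_eigenvector hz.2, map_smul,
      Units.val_mul, hω.pow_val_mul]
  rw [iSup_Icc_eq_iSup_units fun j => homog K p k ⊓ eigSp K p f (ω ^ j)]
  have hfin (g : (ZMod p)ˣ) : Module.Finite K
      (homog K p k ⊓ eigSp K p f (ω ^ (g : ZMod p).val) : Submodule K (Lp K p)) :=
    Submodule.finiteDimensional_inf_left _ _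
  have key := finrank_iSup_eq_card_mul_finrank_fixed (iSupIndep_homog_inf_eigSp hω f k) hr hT hTE
  rw [ZMod.card_units] at key
  exact key

end Paper
end
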